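/- arXiv:2503.20763 — 3 statements merged into one kernel-verified Lean document; each statement's English description precedes it below -/
import Mathlib

section
/- Let P_b and 𝒫^(b) be as above with ‖P_b − 𝒫^(b)‖ < 1 for |ε| small, and let 𝖴_b := [1 − (𝒫^(b) − P_b)²]^{-1/2}(𝒫^(b) P_b + (1 − 𝒫^(b))(1 − P_b)) be the Kato-Nagy unitary, which satisfies 𝖴_b P_b = 𝒫^(b) 𝖴_b. Then there exist ε₀, C, α > 0 such that for all |ε| ≤ ε₀ the operator 𝖴_b − 1 has an integral kernel obeying |(𝖴_b − 1)(x;x')| ≤ |ε| C e^{−α‖x−x'‖} for all x, x' ∈ ℝ². -/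
/- STATEMENT 12 (Lemma 3.4): the Kato–Nagy unitary
`𝖴_b = [1 − (𝒫⁽ᵇ⁾ − P_b)²]^{-1/2}(𝒫⁽ᵇ⁾P_b + (1 − 𝒫⁽ᵇ⁾)(1 − P_b))` intertwining the
Riesz projection `P_b` and the approximate projection `𝒫⁽ᵇ⁾` satisfies
`|(𝖴_b − 1)(x;x')| ≤ |ε| C e^{−α‖x−x'‖}` for all `|ε| ≤ ε₀`. -/

open MeasureTheory Complex

noncomputable section

abbrev Pt : Type := ℝ × ℝ

abbrev L2 : Type := Lp ℂ 2 (volume : Measure Pt)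

/-- `T` is the integral operator with kernel `k`. -/
def HasKernel (T : L2 →L[ℂ] L2) (k : Pt → Pt → ℂ) : Prop :=
  ∀ f : L2, ∀ᵐ x : Pt, (T f : Pt → ℂ) x = ∫ y : Pt, k x y * f y

/-- `(1 − T)^{-1/2}`, defined by the binomial power series
`(1−x)^{-1/2} = Σ_{n≥0} (binom(2n,n)/4ⁿ) xⁿ`, operator-norm convergent for `‖T‖ < 1`. -/
def invSqrtOneSub (T : L2 →L[ℂ] L2) : L2 →L[ℂ] L2 :=
  ∑' n : ℕ, (((Nat.choose (2 * n) n : ℝ) / 4 ^ n) : ℝ) • T ^ n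

/-- The Kato–Nagy unitary `[1 − (Q − P)²]^{-1/2}(Q P + (1 − Q)(1 − P))`. -/
def katoNagy (P Q : L2 →L[ℂ] L2) : L2 →L[ℂ] L2 :=
  invSqrtOneSub ((Q - P) ^ 2) * (Q * P + (1 - Q) * (1 - P))

/-! Helper material -/

/-- `T` has a jointly measurable kernel with bound `M e^{-β|x-y|}`. -/
def Ker (T : L2 →L[ℂ] L2) (M β : ℝ) : Prop :=
  ∃ k : Pt → Pt → ℂ, StronglyMeasurable (Function.uncurry k) ∧ HasKernel T k ∧
    ∀ x y, ‖k x y‖ ≤ M * Real.exp (-β * ‖x - y‖)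

lemma integrable_exp_abs (c : ℝ) (hc : 0 < c) :
    Integrable (fun x : ℝ => Real.exp (-c * |x|)) := by
  rw [← integrableOn_univ, ← Set.Iic_union_Ioi (a := (0 : ℝ))]
  refine IntegrableOn.union ?_ ?_
  · refine (integrableOn_exp_mul_Iic hc 0).congr_fun ?_ measurableSet_Iic
    intro x hx
    simp only [Set.mem_Iic] at hx
    simp [abs_of_nonpos hx]
  · refine (exp_neg_integrableOn_Ioi 0 hc).congr_fun ?_ measurableSet_Ioi
    intro x hx
    simp only [Set.mem_Ioi] at hx
    simp [abs_of_pos hx]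

lemma integrable_exp_norm (c : ℝ) (hc : 0 < c) :
    Integrable (fun z : Pt => Real.exp (-c * ‖z‖)) := by
  have h1 := integrable_exp_abs (c / 2) (by positivity)
  have h2 : Integrable (fun z : Pt => Real.exp (-(c/2) * |z.1|) * Real.exp (-(c/2) * |z.2|)) :=
    h1.mul_prod h1
  refine h2.mono' (by fun_prop) (Filter.Eventually.of_forall fun z => ?_)
  rw [Real.norm_eq_abs, abs_of_pos (Real.exp_pos _), ← Real.exp_add]
  apply Real.exp_le_exp.2
  have a1 : |z.1| ≤ ‖z‖ := norm_fst_le z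
  have a2 : |z.2| ≤ ‖z‖ := norm_snd_le z
  nlinarith

lemma integrable_exp_norm_sub (c : ℝ) (hc : 0 < c) (x : Pt) :
    Integrable (fun z : Pt => Real.exp (-c * ‖x - z‖)) :=
  (integrable_exp_norm c hc).comp_sub_left x

lemma integrable_exp_mul_L2 (c : ℝ) (hc : 0 < c) (x : Pt) (f : L2) :
    Integrable (fun z : Pt => Real.exp (-c * ‖x - z‖) * ‖f z‖) := by
  have h1 : MemLp (fun z : Pt => Real.exp (-c * ‖x - z‖)) 2 := by
    rw [memLp_two_iff_integrable_sq (by fun_prop)]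
    have := integrable_exp_norm_sub (2 * c) (by positivity) x
    refine this.congr (Filter.Eventually.of_forall fun z => ?_)
    simp only [← Real.exp_nat_mul]
    congr 1
    push_cast
    ring
  have h2 : MemLp (fun z : Pt => ‖f z‖) 2 := (Lp.memLp f).norm
  exact h1.integrable_mul h2

lemma ker_integrable {k : Pt → Pt → ℂ} (hk : StronglyMeasurable (Function.uncurry k)) {M β : ℝ}
    (hβ : 0 < β) (hb : ∀ x y, ‖k x y‖ ≤ M * Real.exp (-β * ‖x - y‖)) (x : Pt) (f : L2) :
    Integrable (fun y => k x y * f y) := by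
  refine ((integrable_exp_mul_L2 β hβ x f).const_mul M).mono' ?_
    (Filter.Eventually.of_forall fun z => ?_)
  · have : StronglyMeasurable (fun y => k x y) := hk.comp_measurable measurable_prodMk_left
    exact (this.mul (Lp.stronglyMeasurable f)).aestronglyMeasurable
  · rw [norm_mul, ← mul_assoc]
    exact mul_le_mul_of_nonneg_right (hb x z) (norm_nonneg _)

lemma Ker.mono {T : L2 →L[ℂ] L2} {M N β γ : ℝ} (h : Ker T M β) (hM : M ≤ N) (hN : 0 ≤ N)
    (hγ : γ ≤ β) : Ker T N γ := by
  obtain ⟨k, h1, h2, h3⟩ := h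
  refine ⟨k, h1, h2, fun x y => (h3 x y).trans ?_⟩
  have : Real.exp (-β * ‖x - y‖) ≤ Real.exp (-γ * ‖x - y‖) := by
    apply Real.exp_le_exp.2
    nlinarith [norm_nonneg (x - y)]
  exact mul_le_mul hM this (Real.exp_pos _).le hN

lemma Ker.add {S T : L2 →L[ℂ] L2} {M N β : ℝ} (hβ : 0 < β) (hS : Ker S M β) (hT : Ker T N β) :
    Ker (S + T) (M + N) β := by
  obtain ⟨k, h1, h2, h3⟩ := hS
  obtain ⟨l, g1, g2, g3⟩ := hT
  refine ⟨fun x y => k x y + l x y, h1.add g1, fun f => ?_, fun x y => ?_⟩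
  · filter_upwards [h2 f, g2 f, Lp.coeFn_add (S f) (T f)] with x hx gx ax
    rw [ContinuousLinearMap.add_apply, ax, Pi.add_apply, hx, gx, ← integral_add (ker_integrable h1 hβ h3 x f)
      (ker_integrable g1 hβ g3 x f)]
    simp only [add_mul]
  · rw [add_mul]
    exact (norm_add_le _ _).trans (add_le_add (h3 x y) (g3 x y))

lemma Ker.smul {S : L2 →L[ℂ] L2} {M β : ℝ} (c : ℝ) (hS : Ker S M β) :
    Ker (c • S) (|c| * M) β := by
  obtain ⟨k, h1, h2, h3⟩ := hS
  refine ⟨fun x y => (c : ℂ) * k x y, h1.const_mul (c : ℂ), fun f => ?_, fun x y => ?_⟩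
  · filter_upwards [h2 f, Lp.coeFn_smul c (S f)] with x hx ax
    rw [ContinuousLinearMap.smul_apply, ax, Pi.smul_apply, hx]
    simp only [mul_assoc]
    rw [integral_const_mul]
    simp
  · rw [norm_mul, mul_assoc]
    simp only [norm_real, Real.norm_eq_abs]
    exact mul_le_mul_of_nonneg_left (h3 x y) (abs_nonneg _)

lemma Ker.sub {S T : L2 →L[ℂ] L2} {M N β : ℝ} (hβ : 0 < β) (hS : Ker S M β) (hT : Ker T N β) :
    Ker (S - T) (M + N) β := by
  have := hS.add hβ (hT.smul (-1))
  simpa [sub_eq_add_neg] using this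

lemma exp_split {α β : ℝ} (hβ : 0 < β) (x y z : Pt) :
    Real.exp (-α * ‖x - z‖) * Real.exp (-β * ‖z - y‖) ≤
      Real.exp (-(α - β) * ‖x - z‖) * Real.exp (-β * ‖x - y‖) := by
  rw [← Real.exp_add, ← Real.exp_add]
  apply Real.exp_le_exp.2
  have : ‖x - y‖ ≤ ‖x - z‖ + ‖z - y‖ := norm_sub_le_norm_sub_add_norm_sub x z y
  nlinarith

lemma Ker.mul {A B : L2 →L[ℂ] L2} {M N α β : ℝ} (hM : 0 ≤ M) (hN : 0 ≤ N)
    (hβ : 0 < β) (hαβ : β < α) (hA : Ker A M α) (hB : Ker B N β) :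
    Ker (A * B) (M * N * ∫ z : Pt, Real.exp (-(α - β) * ‖z‖)) β := by
  obtain ⟨k, h1, h2, h3⟩ := hA
  obtain ⟨l, g1, g2, g3⟩ := hB
  have key : ∀ x y z, ‖k x z * l z y‖ ≤
      M * N * (Real.exp (-(α - β) * ‖x - z‖) * Real.exp (-β * ‖x - y‖)) := by
    intro x y z
    rw [norm_mul]
    calc _ ≤ (M * Real.exp (-α * ‖x - z‖)) * (N * Real.exp (-β * ‖z - y‖)) :=
          mul_le_mul (h3 x z) (g3 z y) (norm_nonneg _) (by positivity)
      _ = M * N * (Real.exp (-α * ‖x - z‖) * Real.exp (-β * ‖z - y‖)) := by ring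
      _ ≤ _ := mul_le_mul_of_nonneg_left (exp_split hβ x y z) (by positivity)
  refine ⟨fun x y => ∫ z, k x z * l z y, ?_, fun f => ?_, fun x y => ?_⟩
  · have hm : StronglyMeasurable (fun p : (Pt × Pt) × Pt => k p.1.1 p.2 * l p.2 p.1.2) :=
      (h1.comp_measurable (g := fun p : (Pt × Pt) × Pt => (p.1.1, p.2)) (by fun_prop)).mul
        (g1.comp_measurable (g := fun p : (Pt × Pt) × Pt => (p.2, p.1.2)) (by fun_prop))
    exact hm.integral_prod_right'
  · have hz := g2 f
    filter_upwards [h2 (B f)] with x hx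
    have hint : Integrable (Function.uncurry fun z y : Pt => k x z * (l z y * f y))
        (volume.prod volume) := by
      have hd := ((integrable_exp_norm_sub (α - β) (by linarith) x).mul_prod
        (integrable_exp_mul_L2 β hβ x f)).const_mul (M * N)
      refine hd.mono' ?_ (Filter.Eventually.of_forall fun p => ?_)
      · have hm : StronglyMeasurable (fun p : Pt × Pt => k x p.1 * (l p.1 p.2 * f p.2)) :=
          (h1.comp_measurable (g := fun p : Pt × Pt => (x, p.1)) (by fun_prop)).mul
            ((g1.comp_measurable (g := fun p : Pt × Pt => (p.1, p.2)) (by fun_prop)).mul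
              ((Lp.stronglyMeasurable f).comp_measurable measurable_snd))
        exact hm.aestronglyMeasurable
      · obtain ⟨z, y⟩ := p
        simp only [Function.uncurry_apply_pair]
        rw [← mul_assoc, norm_mul]
        calc _ ≤ _ := mul_le_mul_of_nonneg_right (key x y z) (norm_nonneg (f y))
          _ = _ := by ring
    calc ((A * B) f : Pt → ℂ) x = ∫ z, k x z * (B f) z := hx
      _ = ∫ z, ∫ y, k x z * (l z y * f y) := by
        apply integral_congr_ae
        filter_upwards [hz] with z hz
        rw [hz, integral_const_mul]
      _ = ∫ y, ∫ z, k x z * (l z y * f y) := integral_integral_swap hint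
      _ = _ := by
        congr 1
        ext y
        rw [← integral_mul_const]
        simp only [mul_assoc]
  · have hi := ((integrable_exp_norm_sub (α - β) (by linarith) x).mul_const
      (Real.exp (-β * ‖x - y‖))).const_mul (M * N)
    refine (norm_integral_le_of_norm_le hi (Filter.Eventually.of_forall (key x y))).trans ?_
    rw [integral_const_mul, integral_mul_const,
      integral_sub_left_eq_self (fun z : Pt => Real.exp (-(α - β) * ‖z‖)) volume x, mul_assoc]
    ring_nf
    exact le_rfl

lemma Ker.hasSum {T : ℕ → (L2 →L[ℂ] L2)} {S : L2 →L[ℂ] L2} {a : ℕ → ℝ} {A β : ℝ} (hβ : 0 < β)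
    (hT : ∀ n, Ker (T n) (a n) β) (hS : HasSum T S) (ha : HasSum a A) (ha0 : ∀ n, 0 ≤ a n) :
    Ker S A β := by
  choose k h1 h2 h3 using hT
  have hsum : ∀ x y, Summable fun n => ‖k n x y‖ := fun x y =>
    Summable.of_nonneg_of_le (fun _ => norm_nonneg _) (fun n => h3 n x y) (ha.summable.mul_right _)
  have hlim : ∀ x y, Filter.Tendsto (fun N => ∑ n ∈ Finset.range N, k n x y) Filter.atTop
      (nhds (∑' n, k n x y)) := fun x y => (hsum x y).of_norm.hasSum.tendsto_sum_nat
  have hpb : ∀ N x y, ‖∑ n ∈ Finset.range N, k n x y‖ ≤ A * Real.exp (-β * ‖x - y‖) := by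
    intro N x y
    calc _ ≤ ∑ n ∈ Finset.range N, a n * Real.exp (-β * ‖x - y‖) :=
          norm_sum_le_of_le _ fun n _ => h3 n x y
      _ = (∑ n ∈ Finset.range N, a n) * Real.exp (-β * ‖x - y‖) := by rw [Finset.sum_mul]
      _ ≤ _ := mul_le_mul_of_nonneg_right (sum_le_hasSum _ (fun n _ => ha0 n) ha)
        (Real.exp_pos _).le
  have hpm : ∀ N, StronglyMeasurable (Function.uncurry fun x y => ∑ n ∈ Finset.range N, k n x y) := by
    intro N
    have : (Function.uncurry fun x y => ∑ n ∈ Finset.range N, k n x y) =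
        fun p => ∑ n ∈ Finset.range N, Function.uncurry (k n) p := rfl
    rw [this]
    exact Finset.stronglyMeasurable_fun_sum _ fun n _ => h1 n
  have hpk : ∀ N, HasKernel (∑ n ∈ Finset.range N, T n)
      (fun x y => ∑ n ∈ Finset.range N, k n x y) := by
    intro N
    induction N with
    | zero =>
      intro f
      filter_upwards [Lp.coeFn_zero ℂ 2 (volume : Measure Pt)] with x hx
      simpa using hx
    | succ N ih =>
      intro f
      filter_upwards [ih f, h2 N f, Lp.coeFn_add ((∑ n ∈ Finset.range N, T n) f) (T N f)]
        with x hx gx ax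
      rw [Finset.sum_range_succ, ContinuousLinearMap.add_apply, ax, Pi.add_apply, hx, gx,
        ← integral_add (ker_integrable (hpm N) hβ (hpb N) x f)
        (ker_integrable (h1 N) hβ (h3 N) x f)]
      simp only [add_mul, Finset.sum_range_succ]
  refine ⟨fun x y => ∑' n, k n x y, ?_, fun f => ?_, fun x y => ?_⟩
  · refine stronglyMeasurable_of_tendsto Filter.atTop hpm ?_
    rw [tendsto_pi_nhds]
    exact fun p => hlim p.1 p.2
  · have ht : Filter.Tendsto (fun N => (∑ n ∈ Finset.range N, T n) f) Filter.atTop (nhds (S f)) :=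
      ((ContinuousLinearMap.apply ℂ L2 f).continuous.tendsto S).comp hS.tendsto_sum_nat
    obtain ⟨ns, hns, hae⟩ := (tendstoInMeasure_of_tendsto_Lp ht).exists_seq_tendsto_ae
    filter_upwards [hae, ae_all_iff.2 fun N => hpk N f] with x hx hk
    have hdc : Filter.Tendsto (fun N => ∫ y, (∑ n ∈ Finset.range N, k n x y) * f y) Filter.atTop
        (nhds (∫ y, (∑' n, k n x y) * f y)) := by
      refine tendsto_integral_of_dominated_convergence
        (fun y => A * (Real.exp (-β * ‖x - y‖) * ‖f y‖))
        (fun N => (ker_integrable (hpm N) hβ (hpb N) x f).aestronglyMeasurable)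
        ((integrable_exp_mul_L2 β hβ x f).const_mul A) (fun N => Filter.Eventually.of_forall fun y => ?_)
        (Filter.Eventually.of_forall fun y => (hlim x y).mul_const _)
      rw [norm_mul, ← mul_assoc]
      exact mul_le_mul_of_nonneg_right (hpb N x y) (norm_nonneg _)
    refine tendsto_nhds_unique hx ?_
    have := hdc.comp hns.tendsto_atTop
    refine this.congr fun i => ?_
    exact (hk (ns i)).symm
  · exact le_of_tendsto (hlim x y).norm (Filter.Eventually.of_forall fun N => hpb N x y)

lemma Ker.pow {D : L2 →L[ℂ] L2} {a β : ℝ} (ha : 0 ≤ a) (hβ : 0 < β) (hD : Ker D a (β + β)) (n : ℕ) :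
    Ker (D ^ (n + 1)) (a * (a * ∫ z : Pt, Real.exp (-β * ‖z‖)) ^ n) β := by
  have hK : 0 ≤ ∫ z : Pt, Real.exp (-β * ‖z‖) := integral_nonneg fun z => (Real.exp_pos _).le
  induction n with
  | zero => simpa using hD.mono le_rfl ha (by linarith)
  | succ n ih =>
    rw [pow_succ']
    have := Ker.mul ha (by positivity) hβ (by linarith) hD ih
    rw [add_sub_cancel_right] at this
    refine this.mono (le_of_eq ?_) (by positivity) le_rfl
    ring

lemma coeff_nonneg (n : ℕ) : 0 ≤ (Nat.choose (2 * n) n : ℝ) / 4 ^ n := by positivity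

lemma coeff_le (n : ℕ) : (Nat.choose (2 * n) n : ℝ) / 4 ^ n ≤ 1 := by
  rw [div_le_one (by positivity)]
  exact_mod_cast Nat.centralBinom_le_four_pow n

lemma summable_invSqrt {T : L2 →L[ℂ] L2} (hT : ‖T‖ < 1) :
    Summable fun n : ℕ => (((Nat.choose (2 * n) n : ℝ) / 4 ^ n) : ℝ) • T ^ n := by
  refine Summable.of_norm_bounded (summable_norm_geometric_of_norm_lt_one hT) fun n => ?_
  rw [norm_smul, Real.norm_of_nonneg (coeff_nonneg n)]
  exact mul_le_of_le_one_left (norm_nonneg _) (coeff_le n)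

lemma invSqrt_commute {T R : L2 →L[ℂ] L2} (hT : ‖T‖ < 1) (h : Commute R T) :
    Commute R (invSqrtOneSub T) := by
  have hs := summable_invSqrt hT
  unfold invSqrtOneSub Commute SemiconjBy
  rw [← hs.tsum_mul_left, ← hs.tsum_mul_right]
  congr 1
  ext1 n
  rw [mul_smul_comm, smul_mul_assoc, (h.pow_right n).eq]

lemma invSqrt_sub_one {D : L2 →L[ℂ] L2} {a β : ℝ} (ha : 0 ≤ a) (hβ : 0 < β)
    (hD : Ker D a (β + β)) (hT : ‖D ^ 2‖ < 1)
    (hsmall : a * ∫ z : Pt, Real.exp (-β * ‖z‖) ≤ 1 / 2) :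
    Ker (invSqrtOneSub (D ^ 2) - 1) (2 * a) β := by
  have hK : 0 ≤ ∫ z : Pt, Real.exp (-β * ‖z‖) := integral_nonneg fun z => (Real.exp_pos _).le
  have hs := (summable_invSqrt hT).hasSum
  have hs' := (hasSum_nat_add_iff' 1).2 hs
  have he : (∑' n : ℕ, (((Nat.choose (2 * n) n : ℝ) / 4 ^ n) : ℝ) • (D ^ 2) ^ n) -
      ∑ n ∈ Finset.range 1, (((Nat.choose (2 * n) n : ℝ) / 4 ^ n) : ℝ) • (D ^ 2) ^ n =
      invSqrtOneSub (D ^ 2) - 1 := by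
    simp [invSqrtOneSub]
  rw [he] at hs'
  have hg : HasSum (fun n : ℕ => a * (1 / 2 : ℝ) ^ n) (2 * a) := by
    have := hasSum_geometric_two.mul_left a
    rwa [mul_comm a 2] at this
  refine Ker.hasSum hβ (fun n => ?_) hs' hg (fun n => by positivity)
  have hp := (Ker.pow ha hβ hD (2 * n + 1)).smul
    ((Nat.choose (2 * (n + 1)) (n + 1) : ℝ) / 4 ^ (n + 1))
  rw [← pow_mul, show 2 * (n + 1) = 2 * n + 1 + 1 by ring]
  rw [show 2 * (n + 1) = 2 * n + 1 + 1 by ring] at hp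
  refine hp.mono ?_ (by positivity) le_rfl
  have hc := coeff_le (n + 1)
  have hc0 := coeff_nonneg (n + 1)
  rw [show 2 * (n + 1) = 2 * n + 1 + 1 by ring] at hc hc0
  rw [abs_of_nonneg hc0]
  refine (mul_le_of_le_one_left (by positivity) hc).trans ?_
  refine mul_le_mul_of_nonneg_left ?_ ha
  calc _ ≤ (1 / 2 : ℝ) ^ (2 * n + 1) := pow_le_pow_left₀ (by positivity) hsmall _
    _ ≤ _ := pow_le_pow_of_le_one (by norm_num) (by norm_num) (by omega)

lemma kn_intertwine {P Q : L2 →L[ℂ] L2} (hP : IsIdempotentElem P) (hQ : IsIdempotentElem Q)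
    (hT : ‖(Q - P) ^ 2‖ < 1) : katoNagy P Q * P = Q * katoNagy P Q := by
  have hP' : P * P = P := hP
  have hQ' : Q * Q = Q := hQ
  have hc : Commute Q ((Q - P) ^ 2) := by
    unfold Commute SemiconjBy
    have e1 : Q * (Q - P) ^ 2 = Q * Q * Q - Q * Q * P - Q * P * Q + Q * (P * P) := by noncomm_ring
    have e2 : (Q - P) ^ 2 * Q = Q * Q * Q - Q * P * Q - P * (Q * Q) + P * P * Q := by noncomm_ring
    rw [e1, e2, hP', hQ', hQ']
    abel
  have hcs := (invSqrt_commute hT hc).eq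
  unfold katoNagy
  have e3 : (Q * P + (1 - Q) * (1 - P)) * P = Q * (Q * P + (1 - Q) * (1 - P)) := by
    have l : (Q * P + (1 - Q) * (1 - P)) * P =
      Q * (P * P) + P - P * P - Q * P + Q * (P * P) := by noncomm_ring
    have r : Q * (Q * P + (1 - Q) * (1 - P)) =
      Q * Q * P + Q - Q * P - Q * Q + Q * Q * P := by noncomm_ring
    rw [l, r, hP', hQ']
    abel
  rw [mul_assoc, e3, ← mul_assoc, ← mul_assoc, hcs]

lemma kn_sub_one {P Q S : L2 →L[ℂ] L2} (hP : IsIdempotentElem P) (hQ : IsIdempotentElem Q) :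
    S * (Q * P + (1 - Q) * (1 - P)) - 1 =
      (S - 1) + (S - 1) * ((Q - P) * P - Q * (Q - P)) + ((Q - P) * P - Q * (Q - P)) := by
  have e : Q * P + (1 - Q) * (1 - P) = 1 + ((Q - P) * P - Q * (Q - P)) := by
    have r : (Q - P) * P - Q * (Q - P) = Q * P - P * P - Q * Q + Q * P := by noncomm_ring
    rw [r, hP.eq, hQ.eq]
    noncomm_ring
  rw [e]
  noncomm_ring

theorem statement12
    (b₀ : ℝ) (ε₁ : ℝ) (hε₁ : 0 < ε₁)
    -- the Riesz projections `P_b` and the approximate projections `𝒫⁽ᵇ⁾`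
    (P Q : ℝ → (L2 →L[ℂ] L2))
    (hP : ∀ b : ℝ, IsSelfAdjoint (P b) ∧ IsIdempotentElem (P b))
    (hQ : ∀ b : ℝ, IsSelfAdjoint (Q b) ∧ IsIdempotentElem (Q b))
    -- their jointly continuous, exponentially localized kernels, with the
    -- closeness estimate `|P_b(x;y) − 𝒫⁽ᵇ⁾(x;y)| ≤ |ε| C₀ e^{−α₀‖x−y‖}`
    (pk qk : ℝ → Pt → Pt → ℂ)
    (hpk : ∀ ε : ℝ, |ε| ≤ ε₁ → HasKernel (P (b₀ + ε)) (pk (b₀ + ε)) ∧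
      Continuous (Function.uncurry (pk (b₀ + ε))))
    (hqk : ∀ ε : ℝ, |ε| ≤ ε₁ → HasKernel (Q (b₀ + ε)) (qk (b₀ + ε)) ∧
      Continuous (Function.uncurry (qk (b₀ + ε))))
    (C₀ α₀ : ℝ) (hC₀ : 0 < C₀) (hα₀ : 0 < α₀)
    (hbd : ∀ ε : ℝ, |ε| ≤ ε₁ → ∀ x y : Pt,
      ‖pk (b₀ + ε) x y‖ ≤ C₀ * Real.exp (-α₀ * ‖x - y‖) ∧
      ‖qk (b₀ + ε) x y‖ ≤ C₀ * Real.exp (-α₀ * ‖x - y‖) ∧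
      ‖pk (b₀ + ε) x y - qk (b₀ + ε) x y‖ ≤ |ε| * C₀ * Real.exp (-α₀ * ‖x - y‖))
    (hnorm : ∀ ε : ℝ, |ε| ≤ ε₁ → ‖P (b₀ + ε) - Q (b₀ + ε)‖ < 1) :
    ∃ ε₀ C α : ℝ, 0 < ε₀ ∧ ε₀ ≤ ε₁ ∧ 0 < C ∧ 0 < α ∧
      ∀ ε : ℝ, |ε| ≤ ε₀ →
        -- `𝖴_b` intertwines: `𝖴_b P_b = 𝒫⁽ᵇ⁾ 𝖴_b`
        katoNagy (P (b₀ + ε)) (Q (b₀ + ε)) * P (b₀ + ε)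
          = Q (b₀ + ε) * katoNagy (P (b₀ + ε)) (Q (b₀ + ε)) ∧
        -- `𝖴_b − 1` has an exponentially localized integral kernel
        ∃ kU : Pt → Pt → ℂ,
          HasKernel (katoNagy (P (b₀ + ε)) (Q (b₀ + ε)) - 1) kU ∧
          ∀ x x' : Pt, ‖kU x x'‖ ≤ |ε| * C * Real.exp (-α * ‖x - x'‖) := by
  have hK0 : 0 ≤ ∫ z : Pt, Real.exp (-(α₀ / 2) * ‖z‖) :=
    integral_nonneg fun z => (Real.exp_pos _).le
  have hK1 : 0 ≤ ∫ z : Pt, Real.exp (-(α₀ / 4) * ‖z‖) :=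
    integral_nonneg fun z => (Real.exp_pos _).le
  obtain ⟨K0, hK0e⟩ : ∃ K0, K0 = ∫ z : Pt, Real.exp (-(α₀ / 2) * ‖z‖) := ⟨_, rfl⟩
  obtain ⟨K1, hK1e⟩ : ∃ K1, K1 = ∫ z : Pt, Real.exp (-(α₀ / 4) * ‖z‖) := ⟨_, rfl⟩
  rw [← hK0e] at hK0
  rw [← hK1e] at hK1
  refine ⟨min ε₁ (1 / (2 * C₀ * (K0 + 1))), 2 * C₀ + 2 * C₀ * C₀ * K1 + 2 * C₀ * C₀ * K0, α₀ / 4,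
    lt_min hε₁ (by positivity), min_le_left _ _, by positivity, by positivity, ?_⟩
  intro ε hε
  have hε1 : |ε| ≤ ε₁ := hε.trans (min_le_left _ _)
  have hε2 : |ε| ≤ 1 / (2 * C₀ * (K0 + 1)) := hε.trans (min_le_right _ _)
  obtain ⟨p1, p2⟩ := hpk ε hε1
  obtain ⟨q1, q2⟩ := hqk ε hε1
  have hb := hbd ε hε1
  have hn := hnorm ε hε1
  have hPi := (hP (b₀ + ε)).2
  have hQi := (hQ (b₀ + ε)).2
  generalize P (b₀ + ε) = P' at *
  generalize Q (b₀ + ε) = Q' at *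
  generalize pk (b₀ + ε) = pk' at *
  generalize qk (b₀ + ε) = qk' at *
  have hT : ‖(Q' - P') ^ 2‖ < 1 := by
    rw [norm_sub_rev] at hn
    refine (norm_pow_le' _ (by norm_num)).trans_lt ?_
    exact pow_lt_one₀ (norm_nonneg _) hn (by norm_num)
  refine ⟨kn_intertwine hPi hQi hT, ?_⟩
  have hβ : 0 < α₀ / 2 := by positivity
  have ha : 0 ≤ |ε| * C₀ := by positivity
  have kP : Ker P' C₀ α₀ := ⟨pk', p2.stronglyMeasurable, p1, fun x y => (hb x y).1⟩
  have kQ : Ker Q' C₀ α₀ := ⟨qk', q2.stronglyMeasurable, q1, fun x y => (hb x y).2.1⟩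
  have kD : Ker (Q' - P') (|ε| * C₀) α₀ := by
    refine ⟨fun x y => qk' x y - pk' x y, (q2.sub p2).stronglyMeasurable, fun f => ?_,
      fun x y => ?_⟩
    · filter_upwards [q1 f, p1 f, Lp.coeFn_sub (Q' f) (P' f)] with x hx gx ax
      rw [ContinuousLinearMap.sub_apply, ax, Pi.sub_apply, hx, gx,
        ← integral_sub (ker_integrable q2.stronglyMeasurable hα₀ (fun x y => (hb x y).2.1) x f)
        (ker_integrable p2.stronglyMeasurable hα₀ (fun x y => (hb x y).1) x f)]
      simp only [sub_mul]
    · rw [norm_sub_rev]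
      exact (hb x y).2.2
  have hsm : |ε| * C₀ * K0 ≤ 1 / 2 := by
    rw [le_div_iff₀ (by positivity)] at hε2
    nlinarith [mul_nonneg (abs_nonneg ε) hC₀.le]
  have kS : Ker (invSqrtOneSub ((Q' - P') ^ 2) - 1) (2 * (|ε| * C₀)) (α₀ / 2) :=
    invSqrt_sub_one ha hβ (by simpa using kD) hT (by rw [← hK0e]; exact hsm)
  have half : α₀ - α₀ / 2 = α₀ / 2 := by ring
  have k1 := Ker.mul ha hC₀.le hβ (by linarith) kD (kP.mono le_rfl hC₀.le (by linarith))
  have k2 := Ker.mul hC₀.le ha hβ (by linarith) kQ (kD.mono le_rfl ha (by linarith))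
  rw [half, ← hK0e] at k1 k2
  have kW := k1.sub hβ k2
  have hNW : 0 ≤ |ε| * C₀ * C₀ * K0 + C₀ * (|ε| * C₀) * K0 := by positivity
  have kW' := kW.mono (γ := α₀ / 4) le_rfl hNW (by linarith)
  have kSW := Ker.mul (by positivity) hNW (by positivity) (by linarith) kS kW'
  rw [show α₀ / 2 - α₀ / 4 = α₀ / 4 by ring, ← hK1e] at kSW
  have kF := ((kS.mono (γ := α₀ / 4) le_rfl (by positivity) (by linarith)).add
    (by positivity) kSW).add (by positivity) kW'
  rw [← kn_sub_one hPi hQi] at kF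
  have hle : 2 * (|ε| * C₀) + 2 * (|ε| * C₀) *
      (|ε| * C₀ * C₀ * K0 + C₀ * (|ε| * C₀) * K0) * K1 +
      (|ε| * C₀ * C₀ * K0 + C₀ * (|ε| * C₀) * K0) ≤
      |ε| * (2 * C₀ + 2 * C₀ * C₀ * K1 + 2 * C₀ * C₀ * K0) := by
    have : 0 ≤ |ε| * C₀ * C₀ * K1 := by positivity
    nlinarith [mul_le_mul_of_nonneg_left hsm this]
  obtain ⟨kU, -, hU, hUb⟩ := kF.mono hle (by positivity) le_rfl
  exact ⟨kU, hU, hUb⟩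
end
end

section
/- Let F(x) = Σ_{n≥1} a_n x^n be a power series with convergence radius r > 0. Let D be a bounded operator on L²(ℝ²) with a jointly continuous integral kernel satisfying |D(x;y)| ≤ C e^{−α‖x−y‖} for some C, α > 0 and all x, y ∈ ℝ². If ‖D‖ < r, then there exist 0 < α' < α and C' > 0 such that F(D) also has a jointly continuous integral kernel satisfying |F(D)(x;y)| ≤ C' e^{−α'‖x−y‖} for all x, y ∈ ℝ². -/
/- STATEMENT 17 (Lemma A.1): if `F(x) = Σ_{n≥1} aₙ xⁿ` has convergence radius `r > 0`
and `D` is bounded with a jointly continuous kernel `|D(x;y)| ≤ C e^{−α‖x−y‖}` and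
`‖D‖ < r`, then `F(D)` has a jointly continuous kernel with
`|F(D)(x;y)| ≤ C' e^{−α'‖x−y‖}` for some `0 < α' < α`, `C' > 0`. -/

open MeasureTheory Complex

noncomputable section

lemma int_exp {β : ℝ} (hβ : 0 < β) :
    Integrable (fun z : Pt => Real.exp (-β * ‖z‖)) := by
  have h := integrable_one_add_norm (E := Pt) (μ := volume) (r := 3) (by
    simp; norm_num)
  refine Integrable.mono' (h.const_mul (6 * Real.exp β / β ^ 3))
    (by fun_prop) (Filter.Eventually.of_forall fun z => ?_)
  have ht : 0 ≤ ‖z‖ := norm_nonneg z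
  set t := ‖z‖
  rw [Real.norm_of_nonneg (Real.exp_pos _).le, Real.rpow_neg (by positivity)]
  have h1 := Real.pow_div_factorial_le_exp (β * (1 + t)) (by positivity) 3
  have h2 : (1 + t) ^ (3 : ℝ) = (1 + t) ^ 3 := by
    rw [← Real.rpow_natCast]; norm_num
  rw [h2]
  have h3 : Real.exp (-β * t) = Real.exp β / Real.exp (β * (1 + t)) := by
    rw [← Real.exp_sub]; congr 1; ring
  rw [h3, div_mul_eq_mul_div, ← div_eq_mul_inv, div_div, div_le_div_iff₀ (Real.exp_pos _) (by positivity)]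
  have h4 : (β * (1 + t)) ^ 3 ≤ 6 * Real.exp (β * (1 + t)) := by
    simp [Nat.factorial] at h1
    linarith
  have := Real.exp_pos β
  calc Real.exp β * ((1 + t) ^ 3 * β ^ 3) = Real.exp β * (β * (1 + t)) ^ 3 := by ring
    _ ≤ Real.exp β * (6 * Real.exp (β * (1 + t))) := by gcongr
    _ = _ := by ring

lemma int_exp_sub {β : ℝ} (hβ : 0 < β) (p : Pt) :
    Integrable (fun z : Pt => Real.exp (-β * ‖p - z‖)) :=
  (int_exp hβ).comp_sub_left p

lemma normsq_eq (f : L2) : ‖f‖ ^ 2 = ∫ z, ‖f z‖ ^ 2 := by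
  have h := inner_self_eq_norm_sq_to_K (𝕜 := ℂ) f
  rw [L2.inner_def] at h
  simp_rw [inner_self_eq_norm_sq_to_K] at h
  have h2 : ∀ z, ((‖f z‖ : ℂ)) ^ 2 = ((‖f z‖ ^ 2 : ℝ) : ℂ) := by intro z; push_cast; rfl
  have h3 : (∫ z, ((‖f z‖ ^ 2 : ℝ) : ℂ)) = ((‖f‖ ^ 2 : ℝ) : ℂ) := by
    push_cast; exact h
  rw [integral_complex_ofReal] at h3
  exact_mod_cast h3.symm

lemma int_normsq (f : L2) : Integrable (fun z => ‖f z‖ ^ 2) :=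
  (memLp_two_iff_integrable_sq_norm (Lp.aestronglyMeasurable f)).1 (Lp.memLp f)

lemma norm_le_of_decay (f : L2) {c β : ℝ} (hβ : 0 < β) (hc : 0 ≤ c) (p : Pt)
    (h : ∀ᵐ z, ‖f z‖ ≤ c * Real.exp (-β * ‖p - z‖)) :
    ‖f‖ ≤ c * √ (∫ z : Pt, Real.exp (-(2 * β) * ‖z‖)) := by
  have h1 : ‖f‖ ^ 2 ≤ c ^ 2 * ∫ z : Pt, Real.exp (-(2 * β) * ‖z‖) := by
    rw [normsq_eq, ← integral_sub_left_eq_self (fun z : Pt => Real.exp (-(2 * β) * ‖z‖)) volume p, ← integral_const_mul]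
    refine integral_mono_ae (int_normsq f)
      ((int_exp_sub (by positivity) p).const_mul _) ?_
    filter_upwards [h] with z hz
    calc ‖f z‖ ^ 2 ≤ (c * Real.exp (-β * ‖p - z‖)) ^ 2 := by gcongr
      _ = _ := by rw [mul_pow, ← Real.exp_nat_mul]; congr 2; push_cast; ring
  have h0 : 0 ≤ ∫ z : Pt, Real.exp (-(2 * β) * ‖z‖) := integral_nonneg fun z => (Real.exp_pos _).le
  refine (sq_le_sq₀ (norm_nonneg _) (by positivity)).1 ?_
  rw [mul_pow, Real.sq_sqrt h0]; exact h1

lemma memLp_of_decay {u : Pt → ℂ} (hu : Continuous u) {c β : ℝ} (hβ : 0 < β)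
    (p : Pt) (h : ∀ z, ‖u z‖ ≤ c * Real.exp (-β * ‖p - z‖)) : MemLp u 2 (volume : Measure Pt) := by
  rw [memLp_two_iff_integrable_sq_norm hu.aestronglyMeasurable]
  refine Integrable.mono' ((int_exp_sub (β := 2 * β) (by positivity) p).const_mul (c ^ 2))
    (by fun_prop) (Filter.Eventually.of_forall fun z => ?_)
  rw [Real.norm_of_nonneg (by positivity)]
  calc ‖u z‖ ^ 2 ≤ (c * Real.exp (-β * ‖p - z‖)) ^ 2 := by gcongr; exact h z
      _ = _ := by rw [mul_pow, ← Real.exp_nat_mul]; congr 2; push_cast; ring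

/-- a continuous exponentially decaying family gives a continuous curve in `L2` -/
lemma cont_family (κ : Pt → Pt → ℂ) (hκ : Continuous (Function.uncurry κ)) {c β : ℝ}
    (hβ : 0 < β) (hc : 0 ≤ c)
    (h : ∀ p z, ‖κ p z‖ ≤ c * Real.exp (-β * ‖p - z‖))
    (U : Pt → L2) (hU : ∀ p, (U p : Pt → ℂ) =ᵐ[volume] κ p) : Continuous U := by
  rw [continuous_iff_continuousAt]
  intro q
  have key : Filter.Tendsto (fun p => ∫ z, ‖κ p z - κ q z‖ ^ 2) (nhds q) (nhds 0) := by
    have h0 : (∫ z : Pt, ‖κ q z - κ q z‖ ^ 2) = 0 := by simp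
    rw [← h0]
    refine continuousAt_of_dominated
      (bound := fun z => (2 * c * Real.exp β) ^ 2 * Real.exp (-(2 * β) * ‖q - z‖)) ?_ ?_ ?_ ?_
    · refine Filter.Eventually.of_forall fun p => Continuous.aestronglyMeasurable ?_
      have h1 : Continuous (κ p) := hκ.comp (by fun_prop : Continuous fun z => (p, z))
      have h2 : Continuous (κ q) := hκ.comp (by fun_prop : Continuous fun z => (q, z))
      fun_prop
    · filter_upwards [Metric.ball_mem_nhds q one_pos] with p hp
      refine Filter.Eventually.of_forall fun z => ?_
      rw [Real.norm_of_nonneg (by positivity)]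
      have hp' : ‖p - q‖ < 1 := by rwa [Metric.mem_ball, dist_eq_norm] at hp
      have h1 : ‖κ p z‖ ≤ c * (Real.exp β * Real.exp (-β * ‖q - z‖)) := by
        refine (h p z).trans ?_
        rw [← Real.exp_add]
        gcongr
        have : ‖q - z‖ ≤ ‖p - q‖ + ‖p - z‖ := by
          rw [norm_sub_rev p q]; exact norm_sub_le_norm_sub_add_norm_sub _ _ _
        nlinarith
      have h2 : ‖κ q z‖ ≤ c * (Real.exp β * Real.exp (-β * ‖q - z‖)) := by
        refine (h q z).trans ?_
        gcongr
        have := Real.one_le_exp hβ.le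
        have := Real.exp_pos (-β * ‖q - z‖)
        nlinarith
      calc ‖κ p z - κ q z‖ ^ 2 ≤ (2 * c * Real.exp β * Real.exp (-β * ‖q - z‖)) ^ 2 := by
            gcongr
            refine (norm_sub_le _ _).trans ?_
            linarith
        _ = _ := by rw [mul_pow, ← Real.exp_nat_mul]; congr 2; push_cast; ring
    · exact (int_exp_sub (by positivity) q).const_mul _
    · refine Filter.Eventually.of_forall fun z => Continuous.continuousAt ?_
      have h1 : Continuous (fun p => κ p z) := hκ.comp (by fun_prop : Continuous fun p => (p, z))
      fun_prop
  have key2 : ∀ p, (∫ z, ‖κ p z - κ q z‖ ^ 2) = ‖U p - U q‖ ^ 2 := by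
    intro p
    rw [normsq_eq]
    refine integral_congr_ae ?_
    filter_upwards [hU p, hU q, Lp.coeFn_sub (U p) (U q)] with z h1 h2 h3
    rw [h3, Pi.sub_apply, h1, h2]
  simp_rw [key2] at key
  rw [ContinuousAt, tendsto_iff_norm_sub_tendsto_zero]
  have := key.sqrt
  simpa [Real.sqrt_sq] using this

lemma int_mul_decay {u : Pt → ℂ} (hu : Continuous u) {c β : ℝ} (hβ : 0 < β)
    (p : Pt) (h : ∀ z, ‖u z‖ ≤ c * Real.exp (-β * ‖p - z‖)) (f : L2) :
    Integrable (fun z => u z * f z) :=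
  MemLp.integrable_mul (p := 2) (q := 2) (memLp_of_decay hu hβ p h) (Lp.memLp f)

lemma schur_dom {g : Pt → ℝ} (hg : Integrable g) {m f : Pt → ℂ}
    (hm : MemLp m 2 (volume : Measure Pt)) (hf : MemLp f 2 (volume : Measure Pt)) (s : ℝ) :
    Integrable (fun p : Pt × Pt => (1/2) * (s⁻¹ * (‖m p.1‖ ^ 2 * g (p.1 - p.2))
      + s * (‖f p.2‖ ^ 2 * g (p.1 - p.2)))) (volume.prod volume) ∧
    ∫ p : Pt × Pt, (1/2) * (s⁻¹ * (‖m p.1‖ ^ 2 * g (p.1 - p.2))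
      + s * (‖f p.2‖ ^ 2 * g (p.1 - p.2))) ∂(volume.prod volume) =
      (1/2) * (s⁻¹ * ((∫ x, ‖m x‖ ^ 2) * ∫ z, g z) + s * ((∫ x, ‖f x‖ ^ 2) * ∫ z, g z)) := by
  have hm2 := (memLp_two_iff_integrable_sq_norm hm.1).1 hm
  have hf2 := (memLp_two_iff_integrable_sq_norm hf.1).1 hf
  have i2 : Integrable (fun p : Pt × Pt => ‖f p.2‖ ^ 2 * g (p.1 - p.2)) (volume.prod volume) :=
    hf2.convolution_integrand (ContinuousLinearMap.mul ℝ ℝ) hg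
  have i1 : Integrable (fun p : Pt × Pt => ‖m p.1‖ ^ 2 * g (p.1 - p.2)) (volume.prod volume) := by
    have := (hm2.convolution_integrand (ContinuousLinearMap.mul ℝ ℝ) hg.comp_neg).swap
    refine this.congr (Filter.Eventually.of_forall fun p => ?_)
    simp
  refine ⟨((i1.const_mul _).add (i2.const_mul _)).const_mul _, ?_⟩
  rw [integral_const_mul, integral_add (i1.const_mul _) (i2.const_mul _), integral_const_mul,
    integral_const_mul, integral_prod _ i1, integral_prod_symm _ i2]
  simp_rw [integral_const_mul, integral_sub_left_eq_self g volume, integral_sub_right_eq_self g,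
    integral_mul_const]

lemma schur_pt {a b c g s : ℝ} (ha : 0 ≤ a) (hb : 0 ≤ b) (hbg : b ≤ g) (hc : 0 ≤ c) (hs : 0 < s) :
    a * (b * c) ≤ (1/2) * (s⁻¹ * (a ^ 2 * g) + s * (c ^ 2 * g)) := by
  have h1 : a * c ≤ (1/2) * (s⁻¹ * a ^ 2 + s * c ^ 2) := by
    have : 0 ≤ s⁻¹ * (a - s * c) ^ 2 := by positivity
    have e : s⁻¹ * (a - s * c) ^ 2 = s⁻¹ * a ^ 2 + s * c ^ 2 - 2 * (a * c) := by
      field_simp; ring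
    linarith
  calc a * (b * c) = (a * c) * b := by ring
    _ ≤ (a * c) * g := by gcongr
    _ ≤ ((1/2) * (s⁻¹ * a ^ 2 + s * c ^ 2)) * g := by
      have : 0 ≤ g := hb.trans hbg
      gcongr
    _ = _ := by ring

lemma schur_integrable {κ : Pt → Pt → ℂ} (hκ : Continuous (Function.uncurry κ))
    {g : Pt → ℝ} (hg : Integrable g) (h : ∀ x y, ‖κ x y‖ ≤ g (x - y)) {m f : Pt → ℂ}
    (hm : MemLp m 2 (volume : Measure Pt)) (hf : MemLp f 2 (volume : Measure Pt)) :
    Integrable (fun p : Pt × Pt => m p.1 * (κ p.1 p.2 * f p.2)) (volume.prod volume) := by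
  refine (schur_dom hg hm hf 1).1.mono' ?_ (Filter.Eventually.of_forall fun p => ?_)
  · exact hm.1.comp_fst.mul (hκ.aestronglyMeasurable.mul hf.1.comp_snd)
  · rw [norm_mul, norm_mul]
    exact schur_pt (norm_nonneg _) (norm_nonneg _) (h _ _) (norm_nonneg _) one_pos

lemma schur_norm {T : L2 →L[ℂ] L2} {κ : Pt → Pt → ℂ} (hT : HasKernel T κ)
    (hκ : Continuous (Function.uncurry κ))
    {g : Pt → ℝ} (hg : Integrable g) (h : ∀ x y, ‖κ x y‖ ≤ g (x - y)) {s : ℝ} (hs : 0 < s)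
    (hgs : ∫ z, g z ≤ s) : ‖T‖ ≤ s := by
  refine T.opNorm_le_bound hs.le fun f => ?_
  have hm : MemLp (fun x => starRingEnd ℂ ((T f : Pt → ℂ) x)) 2 (volume : Measure Pt) :=
    (Lp.memLp (T f)).star
  have hint := schur_integrable hκ hg h hm (Lp.memLp f)
  have e1 : ((‖T f‖ ^ 2 : ℝ) : ℂ) = ∫ p : Pt × Pt,
      starRingEnd ℂ ((T f : Pt → ℂ) p.1) * (κ p.1 p.2 * f p.2) ∂(volume.prod volume) := by
    rw [integral_prod _ hint]
    have h := inner_self_eq_norm_sq_to_K (𝕜 := ℂ) (T f)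
    rw [L2.inner_def] at h
    push_cast
    refine h.symm.trans (integral_congr_ae ?_)
    filter_upwards [hT f] with x hx
    rw [integral_const_mul, ← hx, RCLike.inner_apply, mul_comm]
  have e2 : ‖T f‖ ^ 2 ≤ (1/2) * (s⁻¹ * (‖T f‖ ^ 2 * ∫ z, g z) + s * (‖f‖ ^ 2 * ∫ z, g z)) := by
    have e3 : ‖T f‖ ^ 2 = ‖((‖T f‖ ^ 2 : ℝ) : ℂ)‖ := by
      rw [Complex.norm_real, Real.norm_of_nonneg (by positivity)]
    have hd := schur_dom hg hm (Lp.memLp f) s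
    refine (e3.trans (congrArg norm e1)).le.trans
      ((norm_integral_le_of_norm_le hd.1 (Filter.Eventually.of_forall fun p => ?_)).trans ?_)
    · rw [norm_mul, norm_mul]
      exact schur_pt (norm_nonneg _) (norm_nonneg _) (h _ _) (norm_nonneg _) hs
    · rw [hd.2, normsq_eq, normsq_eq f]
      simp
  have e4 : (1/2) * (s⁻¹ * (‖T f‖ ^ 2 * ∫ z, g z) + s * (‖f‖ ^ 2 * ∫ z, g z))
      ≤ (1/2) * (s⁻¹ * (‖T f‖ ^ 2 * s) + s * (‖f‖ ^ 2 * s)) := by gcongr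
  have e5 : s⁻¹ * (‖T f‖ ^ 2 * s) = ‖T f‖ ^ 2 := by field_simp
  refine (sq_le_sq₀ (norm_nonneg _) (by positivity)).1 ?_
  rw [e5] at e4
  nlinarith

lemma comp_kernel {D A : L2 →L[ℂ] L2} {k : Pt → Pt → ℂ} (hD : HasKernel D k)
    (hk : Continuous (Function.uncurry k))
    {g : Pt → ℝ} (hg : Integrable g) (h : ∀ x y, ‖k x y‖ ≤ g (x - y))
    (U Y : Pt → L2) (hU : ∀ x, (U x : Pt → ℂ) =ᵐ[volume] fun z => starRingEnd ℂ (k x z))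
    (hY : ∀ y, (Y y : Pt → ℂ) =ᵐ[volume] fun z => k z y) :
    HasKernel (D * A * D) (fun x y => inner ℂ (U x) (A (Y y))) := by
  intro f
  filter_upwards [hD (A (D f))] with x hx
  have h1 : ((D * A * D) f : Pt → ℂ) x = inner ℂ (U x) (A (D f)) := by
    change (D (A (D f)) : Pt → ℂ) x = _
    rw [hx, L2.inner_def]
    refine integral_congr_ae ?_
    filter_upwards [hU x] with z hz
    rw [RCLike.inner_apply, hz, RingHomCompTriple.comp_apply, RingHom.id_apply, mul_comm]
  rw [h1]
  simp_rw [← ContinuousLinearMap.adjoint_inner_left A]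
  set M : L2 := (ContinuousLinearMap.adjoint A) (U x)
  have hm : MemLp (fun x => starRingEnd ℂ ((M : Pt → ℂ) x)) 2 (volume : Measure Pt) :=
    (Lp.memLp M).star
  have hint := schur_integrable hk hg h hm (Lp.memLp f)
  calc (inner ℂ M (D f) : ℂ) = ∫ z, ∫ y, starRingEnd ℂ ((M : Pt → ℂ) z) * (k z y * f y) := by
        rw [L2.inner_def]
        refine integral_congr_ae ?_
        filter_upwards [hD f] with z hz
        rw [integral_const_mul, ← hz, RCLike.inner_apply, mul_comm]
    _ = ∫ y, ∫ z, starRingEnd ℂ ((M : Pt → ℂ) z) * (k z y * f y) := integral_integral_swap hint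
    _ = _ := by
        congr 1
        ext y
        rw [L2.inner_def, ← integral_mul_const]
        refine integral_congr_ae ?_
        filter_upwards [hY y] with z hz
        rw [RCLike.inner_apply, hz]; ring

lemma exists_mulOp {φ : Pt → ℝ} (hφ : Continuous φ) {b : ℝ} (hb : ∀ z, |φ z| ≤ b) :
    ∃ W : L2 →L[ℂ] L2, ∀ f, (W f : Pt → ℂ) =ᵐ[volume] fun z => (φ z : ℂ) * f z := by
  have hL : ∀ f : L2, MemLp (fun z => (φ z : ℂ) * f z) 2 (volume : Measure Pt) := fun f =>
    (Lp.memLp f).of_le_mul (c := b)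
      ((Complex.continuous_ofReal.comp hφ).aestronglyMeasurable.mul (Lp.aestronglyMeasurable f))
      (Filter.Eventually.of_forall fun z => by
        rw [norm_mul, Complex.norm_real]
        exact mul_le_mul_of_nonneg_right (hb z) (norm_nonneg _))
  let W0 : L2 →ₗ[ℂ] L2 :=
    { toFun := fun f => (hL f).toLp _
      map_add' := fun f g => by
        rw [← MemLp.toLp_add, MemLp.toLp_eq_toLp_iff]
        filter_upwards [Lp.coeFn_add f g] with z hz
        rw [hz]
        simp only [Pi.add_apply, mul_add]
      map_smul' := fun c f => by
        rw [RingHom.id_apply, ← MemLp.toLp_const_smul, MemLp.toLp_eq_toLp_iff]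
        filter_upwards [Lp.coeFn_smul c f] with z hz
        simp [hz]; ring }
  refine ⟨W0.mkContinuous b fun f => ?_, fun f => ?_⟩
  · refine Lp.norm_le_mul_norm_of_ae_le_mul ?_
    filter_upwards [(hL f).coeFn_toLp] with z hz
    change ‖((hL f).toLp _ : Pt → ℂ) z‖ ≤ _
    rw [hz, norm_mul, Complex.norm_real]
    exact mul_le_mul_of_nonneg_right (hb z) (norm_nonneg _)
  · exact (hL f).coeFn_toLp

lemma exp_diff_bound {α α' t s : ℝ} (hα : 0 < α) (hα' : 0 < α') (hle : α' ≤ α / 2) (ht : 0 ≤ t)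
    (hs : |s| ≤ t) :
    Real.exp (-α * t) * |Real.exp (α' * s) - 1| ≤ α' * (4 / α * Real.exp (-(α / 4) * t)) := by
  have h1 : |Real.exp (α' * s) - 1| ≤ α' * t * Real.exp (α' * t) := by
    have hs' := abs_le.1 hs
    have a1 := Real.add_one_le_exp (α' * s)
    have a2 := Real.add_one_le_exp (-(α' * t))
    have a3 : Real.exp (α' * s) ≤ Real.exp (α' * t) := by gcongr; exact hs'.2
    have a4 : Real.exp (-(α' * t)) * Real.exp (α' * t) = 1 := by
      rw [← Real.exp_add]; simp
    have a5 := Real.exp_pos (α' * t)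
    have a6 : 1 ≤ Real.exp (α' * t) := Real.one_le_exp (by positivity)
    have a7 : 0 ≤ α' * t := by positivity
    rw [abs_le]
    constructor
    · nlinarith
    · nlinarith
  have h2 : t ≤ 4 / α * Real.exp (α / 4 * t) := by
    have := Real.add_one_le_exp (α / 4 * t)
    calc t = 4 / α * (α / 4 * t) := by field_simp
      _ ≤ _ := by gcongr; linarith
  calc Real.exp (-α * t) * |Real.exp (α' * s) - 1|
      ≤ Real.exp (-α * t) * (α' * (4 / α * Real.exp (α / 4 * t)) * Real.exp (α / 2 * t)) := by
        refine mul_le_mul_of_nonneg_left (h1.trans ?_) (Real.exp_pos _).le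
        gcongr
    _ = α' * (4 / α * (Real.exp (-α * t) * Real.exp (α / 4 * t) * Real.exp (α / 2 * t))) := by ring
    _ = _ := by
        rw [← Real.exp_add, ← Real.exp_add]
        congr 3
        ring

lemma conj_bound {D : L2 →L[ℂ] L2} {k : Pt → Pt → ℂ} (hker : HasKernel D k)
    (hk : Continuous (Function.uncurry k)) {C α α' : ℝ} (hC : 0 < C) (hα : 0 < α)
    (hkbd : ∀ x y : Pt, ‖k x y‖ ≤ C * Real.exp (-α * ‖x - y‖))
    (hα' : 0 < α') (hle : α' ≤ α / 2)
    {ψ : Pt → ℝ} (hψ : Continuous ψ) (hlip : ∀ x y, |ψ x - ψ y| ≤ ‖x - y‖)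
    {W V : L2 →L[ℂ] L2}
    (hW : ∀ f, (W f : Pt → ℂ) =ᵐ[volume] fun z => (Real.exp (α' * ψ z) : ℂ) * f z)
    (hV : ∀ f, (V f : Pt → ℂ) =ᵐ[volume] fun z => (Real.exp (-(α' * ψ z)) : ℂ) * f z) :
    ‖W * D * V - D‖ ≤
      α' * (C * (4 / α) * (∫ z : Pt, Real.exp (-(α / 4) * ‖z‖)) + 1) := by
  have hkx : ∀ x, Continuous (k x) := fun x => hk.comp (by fun_prop : Continuous fun z => (x, z))
  have h0 : 0 ≤ ∫ z : Pt, Real.exp (-(α / 4) * ‖z‖) := integral_nonneg fun z => (Real.exp_pos _).le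
  have hT : HasKernel (W * D * V - D)
      (fun x y => k x y * ((Real.exp (α' * (ψ x - ψ y)) - 1 : ℝ) : ℂ)) := by
    intro f
    filter_upwards [hker f, hker (V f), hW (D (V f)), Lp.coeFn_sub (W (D (V f))) (D f)]
      with x h1 h2 h3 h4
    change ((W (D (V f)) - D f : L2) : Pt → ℂ) x = _
    rw [h4, Pi.sub_apply, h3, h2, h1, ← integral_const_mul, ← integral_sub
      ((int_mul_decay (hkx x) hα x (hkbd x) (V f)).const_mul _)
      (int_mul_decay (hkx x) hα x (hkbd x) f)]
    refine integral_congr_ae ?_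
    filter_upwards [hV f] with y hy
    rw [hy, mul_sub, Real.exp_sub, Real.exp_neg]
    push_cast
    ring
  refine schur_norm hT (g := fun z => C * (α' * (4 / α * Real.exp (-(α / 4) * ‖z‖)))) ?_ ?_ ?_
    (by positivity) ?_
  · refine Continuous.mul hk ?_
    refine Complex.continuous_ofReal.comp ?_
    fun_prop
  · exact (((int_exp (by positivity)).const_mul _).const_mul _).const_mul _
  · intro x y
    rw [norm_mul, Complex.norm_real, Real.norm_eq_abs]
    calc ‖k x y‖ * |Real.exp (α' * (ψ x - ψ y)) - 1|
        ≤ C * Real.exp (-α * ‖x - y‖) * |Real.exp (α' * (ψ x - ψ y)) - 1| := by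
          gcongr; exact hkbd x y
      _ = C * (Real.exp (-α * ‖x - y‖) * |Real.exp (α' * (ψ x - ψ y)) - 1|) := by ring
      _ ≤ _ := by
          refine mul_le_mul_of_nonneg_left ?_ hC.le
          exact exp_diff_bound hα hα' hle (norm_nonneg _) (hlip x y)
  · rw [integral_const_mul, integral_const_mul, integral_const_mul]
    nlinarith

lemma pow_norm_le (T : L2 →L[ℂ] L2) {ρ : ℝ} (hT : ‖T‖ ≤ ρ) (n : ℕ) : ‖T ^ n‖ ≤ ρ ^ n := by
  have hρ : 0 ≤ ρ := (norm_nonneg _).trans hT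
  induction n with
  | zero => rw [pow_zero, pow_zero]; exact ContinuousLinearMap.norm_id_le (𝕜 := ℂ) (E := L2)
  | succ n ih =>
    rw [pow_succ, pow_succ]
    exact (norm_mul_le _ _).trans (mul_le_mul ih hT (norm_nonneg _) (by positivity))

lemma series_bd (b : ℕ → ℂ) {ρ : ℝ} (hb : Summable fun n => ‖b n‖ * ρ ^ n)
    (T : L2 →L[ℂ] L2) (hT : ‖T‖ ≤ ρ) :
    Summable (fun n => b n • T ^ n) ∧ ‖∑' n, b n • T ^ n‖ ≤ ∑' n, ‖b n‖ * ρ ^ n := by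
  have h : ∀ n, ‖b n • T ^ n‖ ≤ ‖b n‖ * ρ ^ n := fun n => by
    rw [norm_smul]
    exact mul_le_mul_of_nonneg_left (pow_norm_le T hT n) (norm_nonneg _)
  exact ⟨Summable.of_norm_bounded hb h, tsum_of_norm_bounded hb.hasSum h⟩

lemma opconj_pow {W D V : L2 →L[ℂ] L2} (h1 : W * V = 1) (h2 : V * W = 1) (n : ℕ) :
    (W * D * V) ^ n = W * D ^ n * V := by
  induction n with
  | zero => simp [h1]
  | succ n ih =>
    rw [pow_succ, ih, pow_succ]
    calc W * D ^ n * V * (W * D * V) = W * D ^ n * (V * W) * D * V := by simp only [mul_assoc]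
      _ = _ := by rw [h2]; simp only [mul_assoc, one_mul]

lemma conj_series (b : ℕ → ℂ) {W D V : L2 →L[ℂ] L2} (h1 : W * V = 1) (h2 : V * W = 1)
    (hs : Summable fun n => b n • D ^ n) :
    W * (∑' n, b n • D ^ n) * V = ∑' n, b n • (W * D * V) ^ n := by
  rw [← hs.tsum_mul_left, ← (hs.mul_left W).tsum_mul_right]
  refine tsum_congr fun n => ?_
  rw [opconj_pow h1 h2, mul_smul_comm, smul_mul_assoc]

lemma series_split (a : ℕ → ℂ) (ha₀ : a 0 = 0) (D : L2 →L[ℂ] L2)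
    (hs : Summable fun n => a n • D ^ n) (hs2 : Summable fun n => a (n + 2) • D ^ n) :
    ∑' n, a n • D ^ n = a 1 • D + D * (∑' n, a (n + 2) • D ^ n) * D := by
  rw [← hs.sum_add_tsum_nat_add 2, ← hs2.tsum_mul_left, ← (hs2.mul_left D).tsum_mul_right]
  simp only [Finset.sum_range_succ, Finset.sum_range_zero, ha₀, zero_smul, zero_add, pow_one]
  congr 1
  refine tsum_congr fun n => ?_
  rw [mul_smul_comm, smul_mul_assoc, ← pow_succ', ← pow_succ]

theorem statement17
    -- the power series `F(x) = Σ_{n≥1} aₙ xⁿ` with convergence radius `r > 0`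
    (a : ℕ → ℂ) (ha₀ : a 0 = 0) (r : ℝ) (hr : 0 < r)
    (hconv : ∀ x : ℝ, |x| < r → Summable fun n => ‖a n‖ * |x| ^ n)
    (D : L2 →L[ℂ] L2) (k : Pt → Pt → ℂ)
    (hker : HasKernel D k) (hkcont : Continuous (Function.uncurry k))
    (C α : ℝ) (hC : 0 < C) (hα : 0 < α)
    (hkbd : ∀ x y : Pt, ‖k x y‖ ≤ C * Real.exp (-α * ‖x - y‖))
    (hD : ‖D‖ < r) :
    ∃ (α' C' : ℝ), 0 < α' ∧ α' < α ∧ 0 < C' ∧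
      ∃ kF : Pt → Pt → ℂ,
        HasKernel (∑' n : ℕ, a n • D ^ n) kF ∧
        Continuous (Function.uncurry kF) ∧
        ∀ x y : Pt, ‖kF x y‖ ≤ C' * Real.exp (-α' * ‖x - y‖) := by
  have hkx : ∀ x, Continuous (k x) := fun x =>
    hkcont.comp (by fun_prop : Continuous fun z => (x, z))
  have hky : ∀ y, Continuous (fun z => k z y) := fun y =>
    hkcont.comp (by fun_prop : Continuous fun z => (z, y))
  have hkbd' : ∀ y z : Pt, ‖k z y‖ ≤ C * Real.exp (-α * ‖y - z‖) := fun y z => by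
    rw [norm_sub_rev]; exact hkbd z y
  have hkstar : ∀ x z : Pt, ‖starRingEnd ℂ (k x z)‖ ≤ C * Real.exp (-α * ‖x - z‖) := fun x z => by
    rw [RCLike.norm_conj]; exact hkbd x z
  -- constants
  set S : ℝ := C * (4 / α) * (∫ z : Pt, Real.exp (-(α / 4) * ‖z‖)) + 1 with hS
  have hS0 : 0 < S := by
    have h0 : 0 ≤ ∫ z : Pt, Real.exp (-(α / 4) * ‖z‖) :=
      integral_nonneg fun z => (Real.exp_pos _).le
    positivity
  have hDn := norm_nonneg D
  obtain ⟨ρ, hρ1, hρ2⟩ := exists_between hD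
  have hρ0 : 0 < ρ := lt_of_le_of_lt hDn hρ1
  set α' : ℝ := min (α / 2) ((ρ - ‖D‖) / S) with hα'def
  have hα' : 0 < α' := lt_min (by positivity) (div_pos (by linarith) hS0)
  have hle : α' ≤ α / 2 := min_le_left _ _
  have hαS : α' * S ≤ ρ - ‖D‖ := by
    have : α' ≤ (ρ - ‖D‖) / S := min_le_right _ _
    rwa [le_div_iff₀ hS0] at this
  -- summability
  have sum0 : Summable fun n => ‖a n‖ * ρ ^ n := by
    have := hconv ρ (by rwa [abs_of_pos hρ0])
    rwa [abs_of_pos hρ0] at this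
  have sum2 : Summable fun n => ‖a (n + 2)‖ * ρ ^ n := by
    have h := ((summable_nat_add_iff 2).2 sum0).mul_right ((ρ ^ 2)⁻¹)
    refine h.congr fun n => ?_
    rw [pow_add]
    field_simp
  set B : ℝ := ∑' n, ‖a (n + 2)‖ * ρ ^ n with hB
  have hB0 : 0 ≤ B := tsum_nonneg fun n => by positivity
  have hsD := (series_bd a sum0 D hρ1.le).1
  have hsD2 := (series_bd (fun n => a (n + 2)) sum2 D hρ1.le).1
  have hsplit := series_split a ha₀ D hsD hsD2
  set A : L2 →L[ℂ] L2 := ∑' n, a (n + 2) • D ^ n with hA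
  -- the curves in L2
  let U : Pt → L2 := fun x =>
    (memLp_of_decay (u := fun z => starRingEnd ℂ (k x z)) (RCLike.continuous_conj.comp (hkx x))
      hα x (hkstar x)).toLp _
  have hU : ∀ x, (U x : Pt → ℂ) =ᵐ[volume] fun z => starRingEnd ℂ (k x z) := fun x =>
    MemLp.coeFn_toLp _
  let Y : Pt → L2 := fun y =>
    (memLp_of_decay (u := fun z => k z y) (hky y) hα y (hkbd' y)).toLp _
  have hY : ∀ y, (Y y : Pt → ℂ) =ᵐ[volume] fun z => k z y := fun y => MemLp.coeFn_toLp _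
  have hUc : Continuous U := cont_family (fun x z => starRingEnd ℂ (k x z))
    (RCLike.continuous_conj.comp hkcont) hα hC.le hkstar U hU
  have hYc : Continuous Y := cont_family (fun y z => k z y)
    (hkcont.comp continuous_swap) hα hC.le hkbd' Y hY
  let K : Pt → Pt → ℂ := fun x y => inner ℂ (U x) (A (Y y))
  have hKc : Continuous (Function.uncurry K) := by
    change Continuous fun p : Pt × Pt => (inner ℂ (U p.1) (A (Y p.2)) : ℂ)
    exact (hUc.comp continuous_fst).inner (A.continuous.comp (hYc.comp continuous_snd))
  have hKker : HasKernel (D * A * D) K :=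
    comp_kernel hker hkcont (g := fun z => C * Real.exp (-α * ‖z‖))
      ((int_exp hα).const_mul C) hkbd U Y hU hY
  set J : ℝ := √ (∫ z : Pt, Real.exp (-(2 * (α / 2)) * ‖z‖)) with hJ
  have hJ0 : 0 ≤ J := Real.sqrt_nonneg _
  have hKbd : ∀ x y, ‖K x y‖ ≤ (C * J * (B * (C * J))) * Real.exp (-α' * ‖x - y‖) := by
    intro x y
    let ψ : Pt → ℝ := fun z => min ‖z - y‖ ‖x - y‖
    have hψ : Continuous ψ := by fun_prop
    have hψ0 : ∀ z, 0 ≤ ψ z := fun z => le_min (norm_nonneg _) (norm_nonneg _)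
    have hlip : ∀ u v, |ψ u - ψ v| ≤ ‖u - v‖ := by
      intro u v
      refine (abs_min_sub_min_le_max _ _ _ _).trans ?_
      simp only [sub_self, abs_zero]
      refine max_le ?_ (norm_nonneg _)
      refine (abs_norm_sub_norm_le _ _).trans ?_
      simp
    obtain ⟨W, hW⟩ := exists_mulOp (φ := fun z => Real.exp (α' * ψ z)) (by fun_prop)
      (b := Real.exp (α' * ‖x - y‖)) (fun z => by
        rw [abs_of_pos (Real.exp_pos _)]
        gcongr
        exact min_le_right _ _)
    obtain ⟨V, hV⟩ := exists_mulOp (φ := fun z => Real.exp (-(α' * ψ z))) (by fun_prop)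
      (b := 1) (fun z => by
        rw [abs_of_pos (Real.exp_pos _), Real.exp_le_one_iff, neg_nonpos]
        exact mul_nonneg hα'.le (hψ0 z))
    have hee : ∀ z, (Real.exp (α' * ψ z) : ℂ) * (Real.exp (-(α' * ψ z)) : ℂ) = 1 := fun z => by
      rw [← Complex.ofReal_mul, ← Real.exp_add]; simp
    have hWV : W * V = 1 := by
      ext1 f
      refine Lp.ext ?_
      filter_upwards [hW (V f), hV f] with z h1 h2
      change (W (V f) : Pt → ℂ) z = f z
      rw [h1, h2, ← mul_assoc, hee, one_mul]
    have hVW : V * W = 1 := by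
      ext1 f
      refine Lp.ext ?_
      filter_upwards [hV (W f), hW f] with z h1 h2
      change (V (W f) : Pt → ℂ) z = f z
      rw [h1, h2, ← mul_assoc, mul_comm (_ : ℂ) (Real.exp (α' * ψ z) : ℂ), hee, one_mul]
    have hcb := conj_bound hker hkcont hC hα hkbd hα' hle hψ hlip hW hV
    have hTn : ‖W * D * V‖ ≤ ρ := by
      have : W * D * V = D + (W * D * V - D) := by abel
      rw [this]
      refine (norm_add_le _ _).trans ?_
      linarith
    have hWAV : ‖W * A * V‖ ≤ B := by
      rw [hA, conj_series (fun n => a (n + 2)) hWV hVW hsD2]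
      exact (series_bd (fun n => a (n + 2)) sum2 _ hTn).2
    have hsymm : ∀ u v : L2, (inner ℂ u (V v) : ℂ) = inner ℂ (V u) v := by
      intro u v
      rw [L2.inner_def, L2.inner_def]
      refine integral_congr_ae ?_
      filter_upwards [hV u, hV v] with z h1 h2
      rw [RCLike.inner_apply, RCLike.inner_apply, h1, h2, map_mul, Complex.conj_ofReal]
      ring
    have hK1 : K x y = inner ℂ (V (U x)) ((W * A * V) (W (Y y))) := by
      rw [← hsymm]
      change inner ℂ (U x) (A (Y y)) = inner ℂ (U x) ((V * W) (A ((V * W) (Y y))))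
      rw [hVW]; rfl
    have n1 : ‖V (U x)‖ ≤ C * Real.exp (-α' * ‖x - y‖) * J := by
      refine norm_le_of_decay _ (by positivity) (by positivity) x ?_
      filter_upwards [hV (U x), hU x] with z h1 h2
      rw [h1, h2, norm_mul, Complex.norm_real, Real.norm_of_nonneg (Real.exp_pos _).le]
      calc Real.exp (-(α' * ψ z)) * ‖starRingEnd ℂ (k x z)‖
          ≤ Real.exp (-(α' * ψ z)) * (C * Real.exp (-α * ‖x - z‖)) := by
            gcongr; exact hkstar x z
        _ = C * Real.exp (-(α' * ψ z) + -α * ‖x - z‖) := by rw [Real.exp_add]; ring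
        _ ≤ C * Real.exp (-α' * ‖x - y‖ + -(α / 2) * ‖x - z‖) := by
            refine mul_le_mul_of_nonneg_left (Real.exp_le_exp.2 ?_) hC.le
            have h3 : ‖x - y‖ - ‖x - z‖ ≤ ψ z := by
              refine le_min ?_ ?_
              · have := norm_sub_le_norm_sub_add_norm_sub x z y
                linarith
              · have := norm_nonneg (x - z)
                linarith
            have h4 := mul_le_mul_of_nonneg_left h3 hα'.le
            have h5 := mul_le_mul_of_nonneg_right hle (norm_nonneg (x - z))
            linarith
        _ = _ := by rw [Real.exp_add]; ring
    have n2 : ‖W (Y y)‖ ≤ C * J := by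
      refine norm_le_of_decay _ (by positivity) hC.le y ?_
      filter_upwards [hW (Y y), hY y] with z h1 h2
      rw [h1, h2, norm_mul, Complex.norm_real, Real.norm_of_nonneg (Real.exp_pos _).le]
      calc Real.exp (α' * ψ z) * ‖k z y‖
          ≤ Real.exp (α' * ψ z) * (C * Real.exp (-α * ‖y - z‖)) := by
            gcongr; exact hkbd' y z
        _ = C * Real.exp (α' * ψ z + -α * ‖y - z‖) := by rw [Real.exp_add]; ring
        _ ≤ _ := by
            gcongr
            have h3 : ψ z ≤ ‖y - z‖ := by
              rw [norm_sub_rev y z]; exact min_le_left _ _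
            have h4 := mul_le_mul hle h3 (hψ0 z) (by positivity)
            linarith
    rw [hK1]
    calc ‖(inner ℂ (V (U x)) ((W * A * V) (W (Y y))) : ℂ)‖
        ≤ ‖V (U x)‖ * ‖(W * A * V) (W (Y y))‖ := norm_inner_le_norm _ _
      _ ≤ (C * Real.exp (-α' * ‖x - y‖) * J) * (B * (C * J)) := by
          refine mul_le_mul n1 ?_ (norm_nonneg _) (by positivity)
          refine ((W * A * V).le_opNorm _).trans ?_
          exact mul_le_mul hWAV n2 (norm_nonneg _) hB0
      _ = _ := by ring
  refine ⟨α', ‖a 1‖ * C + C * J * (B * (C * J)) + 1, hα', by linarith, by positivity,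
    fun x y => a 1 * k x y + K x y, ?_, ?_, ?_⟩
  · rw [hsplit]
    intro f
    filter_upwards [hker f, hKker f, Lp.coeFn_add (a 1 • D f) ((D * A * D) f),
      Lp.coeFn_smul (a 1) (D f)] with x h1 h2 h3 h4
    change ((a 1 • D f + (D * A * D) f : L2) : Pt → ℂ) x = _
    have hKx : Continuous (K x) := hKc.comp (by fun_prop : Continuous fun z => (x, z))
    rw [h3, Pi.add_apply, h4, Pi.smul_apply, h1, h2, smul_eq_mul, ← integral_const_mul,
      ← integral_add ((int_mul_decay (hkx x) hα x (hkbd x) f).const_mul _)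
        (int_mul_decay hKx hα' x (hKbd x) f)]
    congr 1
    ext y
    ring
  · exact (continuous_const.mul hkcont).add hKc
  · intro x y
    have h1 : ‖a 1 * k x y‖ ≤ ‖a 1‖ * C * Real.exp (-α' * ‖x - y‖) := by
      rw [norm_mul, mul_assoc]
      refine mul_le_mul_of_nonneg_left ((hkbd x y).trans ?_) (norm_nonneg _)
      gcongr
      linarith
    have h2 := hKbd x y
    have h3 := Real.exp_pos (-α' * ‖x - y‖)
    refine (norm_add_le _ _).trans ?_
    linarith
end
end

section
/- Let P₁ and P₂ be two orthogonal projections on L²(ℝ²) with jointly continuous integral kernels satisfying |P_j(x;y)| ≤ C e^{−α‖x−y‖} for j ∈ {1,2}, some fixed C < ∞, α > 0, and all x, y ∈ ℝ², and assume ‖P₁ − P₂‖ < 1. Then the Kato-Nagy unitary U := [1 − (P₁ − P₂)²]^{-1/2}(P₁P₂ + (1 − P₁)(1 − P₂)), which satisfies P₁U = UP₂, is such that U − 1 has a jointly continuous integral kernel and there exist C' > 0 and 0 < α' < α with |(U − 1)(x;y)| ≤ C' e^{−α'‖x−y‖} for all x, y ∈ ℝ². -/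
/- STATEMENT 18 (Lemma A.2): for two orthogonal projections `P₁, P₂` with jointly
continuous exponentially localized kernels and `‖P₁ − P₂‖ < 1`, the Kato–Nagy
unitary `U = [1 − (P₁−P₂)²]^{-1/2}(P₁P₂ + (1−P₁)(1−P₂))` satisfies `P₁U = UP₂` and
`U − 1` has a jointly continuous kernel with `|(U−1)(x;y)| ≤ C' e^{−α'‖x−y‖}`. -/

open MeasureTheory Complex

noncomputable section

lemma expInt {a : ℝ} (ha : 0 < a) : Integrable (fun z : Pt => Real.exp (-a * ‖z‖)) := by
  have h := integrable_one_add_norm (E := Pt) (μ := volume) (r := 3) (by simp; norm_num)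
  refine (h.const_mul (6 * Real.exp a / a ^ 3)).mono' (by fun_prop) (ae_of_all _ fun z => ?_)
  have h1 := Real.pow_div_factorial_le_exp (a * (1 + ‖z‖)) (by positivity) 3
  have hz : (1 + ‖z‖) ^ (-3 : ℝ) = ((1 + ‖z‖) ^ 3)⁻¹ := by
    rw [Real.rpow_neg (by positivity)]; norm_cast
  rw [Real.norm_of_nonneg (Real.exp_pos _).le, hz]
  have h2 : Real.exp (a * (1 + ‖z‖)) = Real.exp a * Real.exp (a * ‖z‖) := by
    rw [← Real.exp_add]; ring_nf
  rw [h2] at h1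
  have h3 : Real.exp (-a * ‖z‖) = (Real.exp (a * ‖z‖))⁻¹ := by
    rw [← Real.exp_neg]; ring_nf
  rw [h3]
  have hp : 0 < Real.exp (a * ‖z‖) := Real.exp_pos _
  have hq : 0 < (1 + ‖z‖) ^ 3 := by positivity
  simp only [Nat.factorial] at h1
  rw [div_le_iff₀ (by norm_num)] at h1
  rw [div_mul_eq_mul_div, le_div_iff₀ (by positivity), ← div_eq_mul_inv, le_div_iff₀ hq,
    inv_mul_eq_div, div_mul_eq_mul_div, div_le_iff₀ hp]
  push_cast at h1
  nlinarith

lemma expInt' {a : ℝ} (ha : 0 < a) (x : Pt) :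
    Integrable (fun z : Pt => Real.exp (-a * ‖x - z‖)) :=
  (expInt ha).comp_sub_left x

lemma expMem {a : ℝ} (ha : 0 < a) : MemLp (fun z : Pt => Real.exp (-a * ‖z‖)) 2 := by
  rw [memLp_two_iff_integrable_sq (by fun_prop)]
  refine (expInt (a := 2 * a) (by positivity)).congr (ae_of_all _ fun z => ?_)
  simp only
  rw [← Real.exp_nat_mul]; push_cast; ring_nf

def Bd (k : Pt → Pt → ℂ) (C a : ℝ) : Prop := ∀ x y, ‖k x y‖ ≤ C * Real.exp (-a * ‖x - y‖)

lemma Bd.nonneg {k C a} (h : Bd k C a) : 0 ≤ C := by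
  have := (norm_nonneg _).trans (h 0 0)
  simpa using this

lemma Bd.mono {k C C' a b} (h : Bd k C a) (hC : C ≤ C') (hb : b ≤ a) : Bd k C' b := by
  intro x y
  refine (h x y).trans ?_
  have := h.nonneg
  have := this.trans hC
  gcongr

/-- the L2 norm constant -/
def Mc (C a : ℝ) : ℝ := (eLpNorm (fun z : Pt => C * Real.exp (-a * ‖z‖)) 2 volume).toReal

lemma row_le {k C a} (ha : 0 < a) (h : Bd k C a) (x : Pt) :
    eLpNorm (fun z => k x z) 2 volume ≤ ENNReal.ofReal (Mc C a) := by
  rw [Mc, ENNReal.ofReal_toReal ((expMem ha).const_mul C).eLpNorm_ne_top]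
  refine (eLpNorm_mono_real (h x)).trans (le_of_eq ?_)
  exact eLpNorm_comp_measurePreserving (g := fun z : Pt => C * Real.exp (-a * ‖z‖))
    (f := fun z => x - z) (by fun_prop) (Measure.measurePreserving_sub_left volume x)

lemma Bd.swap {k C a} (h : Bd k C a) : Bd (fun x y => k y x) C a := by
  intro x y; rw [norm_sub_rev]; exact h y x

lemma col_le {k C a} (ha : 0 < a) (h : Bd k C a) (y : Pt) :
    eLpNorm (fun z => k z y) 2 volume ≤ ENNReal.ofReal (Mc C a) :=
  row_le ha h.swap y

lemma row_mem {k C a} (ha : 0 < a) (h : Bd k C a) (hk : Continuous (Function.uncurry k)) (x : Pt) :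
    MemLp (fun z => k x z) 2 volume :=
  ⟨(show Continuous (fun z => k x z) by fun_prop).aestronglyMeasurable,
    (row_le ha h x).trans_lt ENNReal.ofReal_lt_top⟩

lemma col_mem {k C a} (ha : 0 < a) (h : Bd k C a) (hk : Continuous (Function.uncurry k)) (x : Pt) :
    MemLp (fun z => k z x) 2 volume :=
  ⟨(show Continuous (fun z => k z x) by fun_prop).aestronglyMeasurable,
    (col_le ha h x).trans_lt ENNReal.ofReal_lt_top⟩

lemma Mc_nonneg {C a} : 0 ≤ Mc C a := ENNReal.toReal_nonneg

/-- Cauchy-Schwarz -/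
lemma cs {f g : Pt → ℂ} (hf : MemLp f 2 volume) (hg : MemLp g 2 volume) :
    ∫ x, ‖f x * g x‖ ≤ (eLpNorm f 2 volume).toReal * (eLpNorm g 2 volume).toReal := by
  have h := eLpNorm_smul_le_mul_eLpNorm (p := 2) (q := 2) (r := 1) hg.1 hf.1
  have e := integral_norm_eq_lintegral_enorm (hf.1.mul hg.1)
  simp only [Pi.mul_apply] at e
  rw [e, ← ENNReal.toReal_mul]
  rw [eLpNorm_one_eq_lintegral_enorm] at h
  exact ENNReal.toReal_mono (ENNReal.mul_ne_top hf.eLpNorm_ne_top hg.eLpNorm_ne_top) h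

lemma row_int {k C a} (ha : 0 < a) (h : Bd k C a) (hk : Continuous (Function.uncurry k)) (x : Pt)
    {f : Pt → ℂ} (hf : MemLp f 2 volume) : Integrable (fun z => k x z * f z) :=
  (row_mem ha h hk x).integrable_mul hf

lemma row_cs {k C a} (ha : 0 < a) (h : Bd k C a) (hk : Continuous (Function.uncurry k)) (x : Pt)
    {f : Pt → ℂ} (hf : MemLp f 2 volume) :
    ∫ z, ‖k x z * f z‖ ≤ Mc C a * (eLpNorm f 2 volume).toReal := by
  refine (cs (row_mem ha h hk x) hf).trans ?_
  gcongr
  exact ENNReal.toReal_le_of_le_ofReal Mc_nonneg (row_le ha h x)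

/-- composition of kernels -/
def conv (k l : Pt → Pt → ℂ) (x y : Pt) : ℂ := ∫ z, k x z * l z y

lemma conv_cont {k l C a C' b} (ha : 0 < a) (hb : 0 ≤ b) (h : Bd k C a) (h' : Bd l C' b)
    (hk : Continuous (Function.uncurry k)) (hl : Continuous (Function.uncurry l)) :
    Continuous (Function.uncurry (conv k l)) := by
  rw [continuous_iff_continuousAt]
  rintro p
  refine continuousAt_of_dominated (F := fun (p : Pt × Pt) z => k p.1 z * l z p.2)
    (bound := fun z => C * Real.exp a * C' * Real.exp (-a * ‖p.1 - z‖)) ?_ ?_ ?_ ?_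
  · refine Filter.Eventually.of_forall fun q => ?_
    exact (show Continuous (fun z => k q.1 z * l z q.2) by fun_prop).aestronglyMeasurable
  · filter_upwards [Metric.ball_mem_nhds p one_pos] with q hq
    refine ae_of_all _ fun z => ?_
    have hq1 : ‖q.1 - p.1‖ ≤ 1 := by
      rw [Metric.mem_ball, dist_eq_norm] at hq
      exact (norm_fst_le (q - p)).trans hq.le
    have h1 : ‖p.1 - z‖ ≤ ‖q.1 - z‖ + 1 := by
      have : p.1 - z = (q.1 - z) - (q.1 - p.1) := by abel
      rw [this]; exact (norm_sub_le _ _).trans (by linarith)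
    have e1 : Real.exp (-a * ‖q.1 - z‖) ≤ Real.exp a * Real.exp (-a * ‖p.1 - z‖) := by
      rw [← Real.exp_add]; apply Real.exp_le_exp.2; nlinarith
    have e2 : Real.exp (-b * ‖z - q.2‖) ≤ 1 := by
      apply Real.exp_le_one_iff.2; nlinarith [norm_nonneg (z - q.2)]
    have := h.nonneg
    have := h'.nonneg
    rw [norm_mul]
    calc ‖k q.1 z‖ * ‖l z q.2‖ ≤ (C * (Real.exp a * Real.exp (-a * ‖p.1 - z‖))) * (C' * 1) := by
          gcongr
          · exact (h _ _).trans (by gcongr)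
          · exact (h' _ _).trans (by gcongr)
      _ = _ := by ring
  · exact (expInt' ha p.1).const_mul _
  · refine ae_of_all _ fun z => Continuous.continuousAt ?_
    fun_prop

def Ic (a : ℝ) : ℝ := ∫ z : Pt, Real.exp (-a * ‖z‖)

lemma Ic_nonneg {a} : 0 ≤ Ic a := integral_nonneg fun _ => (Real.exp_pos _).le

lemma conv_bd {k l C a C' b c} (hca : c < a) (hcb : c ≤ b) (hc : 0 ≤ c)
    (h : Bd k C a) (h' : Bd l C' b) : Bd (conv k l) (C * C' * Ic (a - c)) c := by
  intro x y
  have hI : Integrable (fun z => C * C' * Real.exp (-c * ‖x - y‖) * Real.exp (-(a-c) * ‖x - z‖)) :=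
    (expInt' (sub_pos.2 hca) x).const_mul _
  have := norm_integral_le_of_norm_le (f := fun z => k x z * l z y) hI (ae_of_all _ fun z => ?_)
  · refine this.trans (le_of_eq ?_)
    rw [integral_const_mul, integral_sub_left_eq_self (fun z : Pt => Real.exp (-(a-c) * ‖z‖)), Ic]
    ring
  · have := h.nonneg
    have := h'.nonneg
    rw [norm_mul]
    calc ‖k x z‖ * ‖l z y‖ ≤ (C * Real.exp (-a * ‖x - z‖)) * (C' * Real.exp (-b * ‖z - y‖)) := by
          gcongr
          · exact h _ _
          · exact h' _ _
      _ = C * C' * Real.exp (-a * ‖x - z‖ + -b * ‖z - y‖) := by rw [Real.exp_add]; ring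
      _ ≤ C * C' * Real.exp (-c * ‖x - y‖ + -(a-c) * ‖x - z‖) := by
          have h1 : ‖x - y‖ ≤ ‖x - z‖ + ‖z - y‖ := norm_sub_le_norm_sub_add_norm_sub x z y
          refine mul_le_mul_of_nonneg_left (Real.exp_le_exp.2 ?_) (by positivity)
          nlinarith [norm_nonneg (z - y)]
      _ = _ := by rw [Real.exp_add]; ring

lemma HasKernel.mul {S T k l C a C' b} (ha : 0 < a) (hb : 0 < b) (h : Bd k C a) (h' : Bd l C' b)
    (hk : Continuous (Function.uncurry k)) (hl : Continuous (Function.uncurry l))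
    (hS : HasKernel S k) (hT : HasKernel T l) : HasKernel (S * T) (conv k l) := by
  intro f
  filter_upwards [hS (T f)] with x hx
  have hf := Lp.memLp f
  rw [mul_apply_eq_comp, hx]
  have e1 : ∫ z, k x z * (T f) z = ∫ z, ∫ y, k x z * l z y * f y := by
    refine integral_congr_ae ?_
    filter_upwards [hT f] with z hz
    simp only [hz, ← integral_const_mul, mul_assoc]
  rw [e1, integral_integral_swap]
  · refine integral_congr_ae (ae_of_all _ fun y => ?_)
    simp only [conv, ← integral_mul_const]
  · have hm : AEStronglyMeasurable (Function.uncurry fun z y => k x z * l z y * f y)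
        (volume.prod volume) := by
      refine AEStronglyMeasurable.mul ?_ ?_
      · refine Continuous.aestronglyMeasurable ?_
        fun_prop
      · exact hf.1.comp_snd
    rw [integrable_prod_iff hm]
    constructor
    · refine ae_of_all _ fun z => ?_
      have := (row_int hb h' hl z hf).const_mul (k x z)
      simpa [Function.uncurry, mul_assoc] using this
    · refine Integrable.mono' (g := fun z => (C * (Mc C' b * (eLpNorm f 2 volume).toReal)) *
        Real.exp (-a * ‖x - z‖)) ((expInt' ha x).const_mul _) hm.norm.integral_prod_right'
        (ae_of_all _ fun z => ?_)
      rw [Real.norm_of_nonneg (integral_nonneg fun _ => norm_nonneg _)]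
      have e : ∫ y, ‖Function.uncurry (fun z y => k x z * l z y * f y) (z, y)‖
          = ‖k x z‖ * ∫ y, ‖l z y * f y‖ := by
        rw [← integral_const_mul]; simp [Function.uncurry, mul_assoc]
      rw [e]
      calc _ ≤ (C * Real.exp (-a * ‖x - z‖)) * (Mc C' b * (eLpNorm f 2 volume).toReal) := by
            have := h.nonneg
            gcongr
            · exact h _ _
            · exact row_cs hb h' hl z hf
        _ = _ := by ring

lemma HasKernel.add {S T k l C a C' b} (ha : 0 < a) (hb : 0 < b) (h : Bd k C a) (h' : Bd l C' b)
    (hk : Continuous (Function.uncurry k)) (hl : Continuous (Function.uncurry l))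
    (hS : HasKernel S k) (hT : HasKernel T l) :
    HasKernel (S + T) (fun x y => k x y + l x y) := by
  intro f
  have hf := Lp.memLp f
  filter_upwards [hS f, hT f, Lp.coeFn_add (S f) (T f)] with x h1 h2 h3
  rw [add_apply, h3, Pi.add_apply, h1, h2,
    ← integral_add (row_int ha h hk x hf) (row_int hb h' hl x hf)]
  simp only [add_mul]

lemma HasKernel.smul {S k} (c : ℝ) (hS : HasKernel S k) :
    HasKernel (c • S) (fun x y => (c : ℂ) * k x y) := by
  intro f
  filter_upwards [hS f, Lp.coeFn_smul c (S f)] with x h1 h3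
  rw [smul_apply, h3, Pi.smul_apply, h1]
  simp only [mul_assoc, integral_const_mul, Complex.real_smul]

lemma Bd.add {k l C C' a} (h : Bd k C a) (h' : Bd l C' a) :
    Bd (fun x y => k x y + l x y) (C + C') a := by
  intro x y
  rw [add_mul]
  exact (norm_add_le _ _).trans (add_le_add (h x y) (h' x y))

lemma Bd.smul {k C a} (c : ℝ) (h : Bd k C a) : Bd (fun x y => (c : ℂ) * k x y) (|c| * C) a := by
  intro x y
  rw [norm_mul, Complex.norm_real, mul_assoc]
  exact mul_le_mul_of_nonneg_left (h x y) (abs_nonneg _)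

lemma HasKernel.lim {S : ℕ → L2 →L[ℂ] L2} {T : L2 →L[ℂ] L2} {k : ℕ → Pt → Pt → ℂ}
    {l : Pt → Pt → ℂ} {C a : ℝ} (ha : 0 < a)
    (hST : Filter.Tendsto S Filter.atTop (nhds T))
    (hk : ∀ n, Continuous (Function.uncurry (k n)))
    (hB : ∀ n, Bd (k n) C a) (hS : ∀ n, HasKernel (S n) (k n))
    (hkl : ∀ x y, Filter.Tendsto (fun n => k n x y) Filter.atTop (nhds (l x y))) :
    HasKernel T l := by
  intro f
  have hf := Lp.memLp f
  have h1 : Filter.Tendsto (fun n => S n f) Filter.atTop (nhds (T f)) :=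
    ((ContinuousLinearMap.apply ℂ L2 f).continuous.tendsto T).comp hST
  obtain ⟨ns, hns, h2⟩ := (tendstoInMeasure_of_tendsto_Lp h1).exists_seq_tendsto_ae
  filter_upwards [h2, ae_all_iff.2 fun n => hS n f] with x hx hx'
  refine tendsto_nhds_unique hx ?_
  simp only [hx']
  have h3 : Filter.Tendsto (fun n => ∫ y, k n x y * f y) Filter.atTop
      (nhds (∫ y, l x y * f y)) := by
    refine tendsto_integral_of_dominated_convergence
      (fun y => ‖(C * Real.exp (-a * ‖x - y‖) : ℝ) * f y‖)
      (fun n => (row_int ha (hB n) (hk n) x hf).1) ?_ ?_ ?_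
    · refine Integrable.norm ?_
      refine row_int (k := fun x y => ((C * Real.exp (-a * ‖x - y‖) : ℝ) : ℂ)) (C := C) ha ?_ ?_ x hf
      · intro x y
        have := (hB 0).nonneg
        rw [Complex.norm_real, Real.norm_of_nonneg (by positivity)]
      · simp only [Function.uncurry_def]; fun_prop
    · refine fun n => ae_of_all _ fun y => ?_
      rw [norm_mul, norm_mul, Complex.norm_real]
      gcongr
      exact (hB n x y).trans (le_abs_self _)
    · exact ae_of_all _ fun y => (hkl x y).mul_const _
  exact h3.comp hns.tendsto_atTop

/-- iterated kernels -/
def ek (d : Pt → Pt → ℂ) : ℕ → Pt → Pt → ℂ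
  | 0 => d
  | m + 1 => conv d (ek d m)

lemma ek_bd {d C a} (ha : 0 < a) (h : Bd d C a) (m : ℕ) :
    Bd (ek d m) (C * (C * Ic (a / 2)) ^ m) (a / 2) := by
  induction m with
  | zero => simpa [ek] using h.mono le_rfl (by linarith)
  | succ m ih =>
    have := conv_bd (c := a / 2) (by linarith) le_rfl (by linarith) h ih
    rw [ek]
    refine this.mono (le_of_eq ?_) le_rfl
    rw [sub_half]; ring

lemma ek_cont {d C a} (ha : 0 < a) (h : Bd d C a) (hd : Continuous (Function.uncurry d)) (m : ℕ) :
    Continuous (Function.uncurry (ek d m)) := by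
  induction m with
  | zero => simpa [ek] using hd
  | succ m ih => exact conv_cont ha (by linarith) h (ek_bd ha h m) hd ih

lemma ek_ker {D d C a} (ha : 0 < a) (h : Bd d C a) (hd : Continuous (Function.uncurry d))
    (hD : HasKernel D d) (m : ℕ) : HasKernel (D ^ (m + 1)) (ek d m) := by
  induction m with
  | zero => simpa [ek] using hD
  | succ m ih =>
    rw [pow_succ']
    exact HasKernel.mul ha (half_pos ha) h (ek_bd ha h m) hd (ek_cont ha h hd m) hD ih

lemma ek_col {D d C a} (ha : 0 < a) (h : Bd d C a) (hd : Continuous (Function.uncurry d))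
    (hD : HasKernel D d) (m : ℕ) (y : Pt) :
    (eLpNorm (fun z => ek d m z y) 2 volume).toReal ≤ ‖D‖ ^ m * Mc C a := by
  induction m with
  | zero =>
    simp only [ek, pow_zero, one_mul]
    exact ENNReal.toReal_le_of_le_ofReal Mc_nonneg (col_le ha h y)
  | succ m ih =>
    have hm := col_mem (half_pos ha) (ek_bd ha h m) (ek_cont ha h hd m) y
    have h1 : (D (hm.toLp _) : Pt → ℂ) =ᵐ[volume] fun z => ek d (m + 1) z y := by
      filter_upwards [hD (hm.toLp _)] with x hx
      rw [hx, ek, conv]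
      refine integral_congr_ae ?_
      filter_upwards [hm.coeFn_toLp] with z hz
      rw [hz]
    rw [← eLpNorm_congr_ae h1, ← Lp.norm_def]
    refine (D.le_opNorm _).trans ?_
    rw [Lp.norm_toLp, pow_succ', mul_assoc]
    gcongr

lemma ek_bd2 {D d C a} (ha : 0 < a) (h : Bd d C a) (hd : Continuous (Function.uncurry d))
    (hD : HasKernel D d) (m : ℕ) (x y : Pt) :
    ‖ek d (m + 1) x y‖ ≤ Mc C a * (‖D‖ ^ m * Mc C a) := by
  have hm := col_mem (half_pos ha) (ek_bd ha h m) (ek_cont ha h hd m) y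
  rw [ek, conv]
  refine (norm_integral_le_integral_norm _).trans ((row_cs ha h hd x hm).trans ?_)
  have := Mc_nonneg (C := C) (a := a)
  gcongr
  exact ek_col ha h hd hD m y

lemma interp {t u v θ : ℝ} (ht : 0 ≤ t) (hu : t ≤ u) (hv : t ≤ v) (h0 : 0 ≤ θ) (h1 : θ ≤ 1) :
    t ≤ u ^ (1 - θ) * v ^ θ := by
  have h1' : 0 ≤ 1 - θ := by linarith
  have e : t = t ^ (1 - θ) * t ^ θ := by
    rw [← Real.rpow_add_of_nonneg ht h1' h0]; simp
  rw [e]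
  have := ht.trans hu
  gcongr

lemma exists_theta {q K : ℝ} (hq : 0 < q) (hq1 : q < 1) (hK : 0 < K) :
    ∃ θ : ℝ, 0 < θ ∧ θ < 1 ∧ q ^ (1 - θ) * K ^ θ < 1 := by
  have hc : Continuous (fun θ : ℝ => q ^ (1 - θ) * K ^ θ) := by
    refine Continuous.mul ?_ ?_
    · exact Continuous.rpow continuous_const (by fun_prop) (fun _ => Or.inl hq.ne')
    · exact Continuous.rpow continuous_const (by fun_prop) (fun _ => Or.inl hK.ne')
  have h1 : ∀ᶠ θ in nhds (0 : ℝ), q ^ (1 - θ) * K ^ θ < 1 :=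
    hc.continuousAt.eventually_lt continuousAt_const (by simpa using hq1)
  obtain ⟨ε, hε, h⟩ := Metric.eventually_nhds_iff.1 h1
  refine ⟨min (ε / 2) (1 / 2), by positivity, by
    exact (min_le_right _ _).trans_lt (by norm_num), h ?_⟩
  rw [Real.dist_eq, sub_zero, abs_of_pos (by positivity)]
  exact (min_le_left _ _).trans_lt (by linarith)

lemma ek_interp {D d C a} (ha : 0 < a) (h : Bd d C a) (hd : Continuous (Function.uncurry d))
    (hD : HasKernel D d) (hn : ‖D‖ < 1) :
    ∃ B ρ b : ℝ, 0 ≤ B ∧ 0 ≤ ρ ∧ ρ < 1 ∧ 0 < b ∧ b < a / 2 ∧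
      ∀ m, Bd (ek d (m + 1)) (B * ρ ^ m) b := by
  have hC := h.nonneg
  have hI := Ic_nonneg (a := a / 2)
  have hM := Mc_nonneg (C := C) (a := a)
  obtain ⟨q, hq, hq1⟩ := exists_between hn
  have hq0 : 0 < q := (norm_nonneg _).trans_lt hq
  set K := C * Ic (a / 2) + 1 with hK
  have hK0 : 0 < K := by positivity
  obtain ⟨θ, h0, h1, hθ⟩ := exists_theta hq0 hq1 hK0
  refine ⟨(Mc C a * Mc C a) ^ (1 - θ) * (C * K) ^ θ, q ^ (1 - θ) * K ^ θ, a / 2 * θ,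
    by positivity, by positivity, hθ, by positivity, by nlinarith, fun m x y => ?_⟩
  have hu : ‖ek d (m + 1) x y‖ ≤ (Mc C a * Mc C a) * q ^ m := by
    refine (ek_bd2 ha h hd hD m x y).trans ?_
    have : ‖D‖ ^ m ≤ q ^ m := by gcongr
    nlinarith [mul_nonneg hM hM]
  have hv : ‖ek d (m + 1) x y‖ ≤ (C * K) * K ^ m * Real.exp (-(a / 2) * ‖x - y‖) := by
    refine (ek_bd ha h (m + 1) x y).trans ?_
    rw [mul_assoc C K, ← pow_succ']
    gcongr
    rw [hK]; linarith
  refine (interp (norm_nonneg _) hu hv h0.le h1.le).trans (le_of_eq ?_)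
  have e1 : ∀ s t : ℝ, 0 ≤ s → (s ^ m) ^ t = (s ^ t) ^ m := by
    intro s t hs
    rw [← Real.rpow_natCast, ← Real.rpow_mul hs, mul_comm, Real.rpow_mul hs, Real.rpow_natCast]
  rw [Real.mul_rpow (by positivity) (by positivity),
    Real.mul_rpow (x := C * K * K ^ m) (by positivity) (by positivity),
    Real.mul_rpow (x := C * K) (by positivity) (by positivity), e1 _ _ hq0.le, e1 _ _ hK0.le,
    ← Real.exp_mul, mul_pow]
  ring_nf

def cn (n : ℕ) : ℝ := (Nat.choose (2 * n) n : ℝ) / 4 ^ n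

lemma cn_nonneg (n : ℕ) : 0 ≤ cn n := by unfold cn; positivity

lemma cn_le (n : ℕ) : cn n ≤ 1 := by
  unfold cn
  rw [div_le_one (by positivity)]
  have := Nat.choose_le_two_pow (2 * n) n
  rw [pow_mul] at this
  exact_mod_cast this

lemma cn_zero : cn 0 = 1 := by simp [cn]

lemma summ {T : L2 →L[ℂ] L2} (hT : ‖T‖ < 1) : Summable (fun n => cn n • T ^ n) := by
  refine Summable.of_norm_bounded_eventually_nat (g := fun n => ‖T‖ ^ n)
    (summable_geometric_of_lt_one (norm_nonneg _) hT) ?_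
  filter_upwards [Filter.eventually_gt_atTop 0] with n hn
  rw [norm_smul, Real.norm_of_nonneg (cn_nonneg n)]
  calc cn n * ‖T ^ n‖ ≤ 1 * ‖T‖ ^ n := by
        gcongr
        · exact cn_le n
        · exact norm_pow_le' T hn
    _ = _ := one_mul _

lemma inv_ker {D d C a} (ha : 0 < a) (h : Bd d C a) (hd : Continuous (Function.uncurry d))
    (hD : HasKernel D d) (hn : ‖D‖ < 1) :
    ∃ (B b : ℝ) (s : Pt → Pt → ℂ), 0 < b ∧ b < a / 2 ∧ Bd s B b ∧
      Continuous (Function.uncurry s) ∧ HasKernel (invSqrtOneSub (D ^ 2) - 1) s := by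
  obtain ⟨B, ρ, b, hB, hρ, hρ1, hb, hba, hbd⟩ := ek_interp ha h hd hD hn
  have hT : ‖D ^ 2‖ < 1 := by
    refine (norm_pow_le' D two_pos).trans_lt ?_
    exact pow_lt_one₀ (norm_nonneg _) hn two_ne_zero
  have hρ2 : ρ ^ 2 < 1 := pow_lt_one₀ hρ hρ1 two_ne_zero
  have hsum := (hasSum_geometric_of_lt_one (sq_nonneg ρ) hρ2).mul_left B
  have hterm : ∀ n x y, ‖(cn (n + 1) : ℂ) * ek d (2 * n + 1) x y‖
      ≤ B * (ρ ^ 2) ^ n * Real.exp (-b * ‖x - y‖) := by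
    intro n x y
    have := hbd (2 * n) x y
    rw [pow_mul] at this
    rw [norm_mul, Complex.norm_real, Real.norm_of_nonneg (cn_nonneg _)]
    exact (mul_le_of_le_one_left (norm_nonneg _) (cn_le _)).trans this
  have hterm' : ∀ n x y, ‖(cn (n + 1) : ℂ) * ek d (2 * n + 1) x y‖ ≤ B * (ρ ^ 2) ^ n := by
    intro n x y
    refine (hterm n x y).trans (mul_le_of_le_one_right (by positivity) ?_)
    apply Real.exp_le_one_iff.2; nlinarith [norm_nonneg (x - y)]
  have hcont : ∀ n, Continuous (Function.uncurry fun x y => (cn (n + 1) : ℂ) * ek d (2 * n + 1) x y) :=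
    fun n => continuous_const.mul (ek_cont ha h hd (2 * n + 1))
  have hk : ∀ n, HasKernel (cn (n + 1) • (D ^ 2) ^ (n + 1))
      (fun x y => (cn (n + 1) : ℂ) * ek d (2 * n + 1) x y) := by
    intro n
    have := (ek_ker ha h hd hD (2 * n + 1)).smul (cn (n + 1))
    rwa [show 2 * n + 1 + 1 = 2 * (n + 1) by ring, pow_mul] at this
  refine ⟨B * (1 - ρ ^ 2)⁻¹, b, fun x y => ∑' n, (cn (n + 1) : ℂ) * ek d (2 * n + 1) x y,
    hb, hba, ?_, ?_, ?_⟩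
  · intro x y
    exact tsum_of_norm_bounded (hsum.mul_right _) (fun n => hterm n x y)
  · exact continuous_tsum (f := fun n (p : Pt × Pt) => (cn (n + 1) : ℂ) * ek d (2 * n + 1) p.1 p.2)
      hcont hsum.summable (fun n p => hterm' n p.1 p.2)
  · have hS := summ hT
    have e : invSqrtOneSub (D ^ 2) - 1 = ∑' n, cn (n + 1) • (D ^ 2) ^ (n + 1) := by
      have : invSqrtOneSub (D ^ 2) = ∑' n, cn n • (D ^ 2) ^ n := rfl
      rw [this, hS.tsum_eq_zero_add, cn_zero]
      simp
    have hS' : Summable fun n => cn (n + 1) • (D ^ 2) ^ (n + 1) :=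
      (summable_nat_add_iff (f := fun n => cn n • (D ^ 2) ^ n) 1).2 hS
    rw [e]
    have hcs : ∀ n, Continuous (Function.uncurry fun x y => ∑ i ∈ Finset.range n,
        (cn (i + 1) : ℂ) * ek d (2 * i + 1) x y) := by
      intro n
      exact continuous_finsetSum _ fun i _ => hcont i
    have hbs : ∀ n, Bd (fun x y => ∑ i ∈ Finset.range n,
        (cn (i + 1) : ℂ) * ek d (2 * i + 1) x y) (B * (1 - ρ ^ 2)⁻¹) b := by
      intro n x y
      refine (norm_sum_le_of_le _ fun i _ => hterm i x y).trans ?_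
      exact sum_le_hasSum _ (fun i _ => by positivity) (hsum.mul_right _)
    refine HasKernel.lim (C := B * (1 - ρ ^ 2)⁻¹) hb hS'.tendsto_sum_tsum_nat hcs hbs ?_ ?_
    · intro n
      induction n with
      | zero =>
        intro f
        filter_upwards [Lp.coeFn_zero ℂ 2 (volume : Measure Pt)] with x hx
        simpa using hx
      | succ n ih =>
        simp only [Finset.sum_range_succ]
        refine HasKernel.add (C := B * (1 - ρ ^ 2)⁻¹) (C' := B * (ρ ^ 2) ^ n) hb hb (hbs n) ?_ (hcs n) (hcont n) ih (hk n)
        exact hterm n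
    · intro x y
      exact (Summable.of_norm_bounded hsum.summable
        (fun n => hterm' n x y)).tendsto_sum_tsum_nat

theorem statement18
    (P₁ P₂ : L2 →L[ℂ] L2)
    (hP₁ : IsSelfAdjoint P₁ ∧ IsIdempotentElem P₁)
    (hP₂ : IsSelfAdjoint P₂ ∧ IsIdempotentElem P₂)
    (k₁ k₂ : Pt → Pt → ℂ)
    (hker₁ : HasKernel P₁ k₁) (hker₂ : HasKernel P₂ k₂)
    (hcont₁ : Continuous (Function.uncurry k₁)) (hcont₂ : Continuous (Function.uncurry k₂))
    (C α : ℝ) (hC : 0 < C) (hα : 0 < α)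
    (hbd₁ : ∀ x y : Pt, ‖k₁ x y‖ ≤ C * Real.exp (-α * ‖x - y‖))
    (hbd₂ : ∀ x y : Pt, ‖k₂ x y‖ ≤ C * Real.exp (-α * ‖x - y‖))
    (hnorm : ‖P₁ - P₂‖ < 1) :
    -- the Kato–Nagy unitary
    (invSqrtOneSub ((P₁ - P₂) ^ 2) * (P₁ * P₂ + (1 - P₁) * (1 - P₂))) * P₂
        = P₁ * (invSqrtOneSub ((P₁ - P₂) ^ 2) * (P₁ * P₂ + (1 - P₁) * (1 - P₂))) ∧
    ∃ (C' α' : ℝ), 0 < C' ∧ 0 < α' ∧ α' < α ∧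
      ∃ kU : Pt → Pt → ℂ,
        HasKernel (invSqrtOneSub ((P₁ - P₂) ^ 2) * (P₁ * P₂ + (1 - P₁) * (1 - P₂)) - 1) kU ∧
        Continuous (Function.uncurry kU) ∧
        ∀ x y : Pt, ‖kU x y‖ ≤ C' * Real.exp (-α' * ‖x - y‖) := by
  have comm : Commute P₁ (invSqrtOneSub ((P₁ - P₂) ^ 2)) := by
    unfold invSqrtOneSub
    refine Commute.tsum_right _ fun n => Commute.smul_right (Commute.pow_right ?_ _) _
    have h1 : P₁ * P₁ = P₁ := hP₁.2
    have h2 : P₂ * P₂ = P₂ := hP₂.2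
    have e : (P₁ - P₂) ^ 2 = P₁ - P₁ * P₂ - P₂ * P₁ + P₂ := by
      rw [sq, sub_mul, mul_sub, mul_sub, h1, h2]; abel
    rw [e]
    change P₁ * _ = _ * P₁
    simp only [mul_add, mul_sub, add_mul, sub_mul]
    rw [mul_assoc P₂ P₁ P₁, ← mul_assoc P₁ P₁ P₂, h1, mul_assoc P₁ P₂ P₁]
    abel
  constructor
  · have h1 : P₁ * P₁ = P₁ := hP₁.2
    have h2 : P₂ * P₂ = P₂ := hP₂.2
    rw [← mul_assoc P₁, comm.eq, mul_assoc, mul_assoc]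
    congr 1
    rw [add_mul, mul_add, mul_assoc, h2, mul_assoc (1 - P₁), sub_mul 1 P₂ P₂, h2, ← mul_assoc P₁ P₁,
      h1, ← mul_assoc P₁ (1 - P₁), mul_sub P₁ 1 P₁, h1]
    simp
  have hb1 : Bd k₁ C α := hbd₁
  have hb2 : Bd k₂ C α := hbd₂
  have hbd' : Bd (fun x y => k₁ x y + ((-1 : ℝ) : ℂ) * k₂ x y) (C + |-1| * C) α := hb1.add (hb2.smul (-1))
  have hD : HasKernel (P₁ - P₂) (fun x y => k₁ x y + ((-1 : ℝ) : ℂ) * k₂ x y) := by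
    have := HasKernel.add hα hα hb1 (hb2.smul (-1)) hcont₁ (continuous_const.mul hcont₂) hker₁
      (hker₂.smul (-1))
    rwa [neg_one_smul, ← sub_eq_add_neg] at this
  have hcd : Continuous (Function.uncurry fun x y => k₁ x y + ((-1 : ℝ) : ℂ) * k₂ x y) :=
    hcont₁.add (continuous_const.mul hcont₂)
  obtain ⟨B, b, s, hb, hba, hsb, hsc, hs⟩ := inv_ker hα hbd' hcd hD hnorm
  -- the second factor
  obtain ⟨B2, w, hwb, hwc, hw⟩ : ∃ (B2 : ℝ) (w : Pt → Pt → ℂ), Bd w B2 (α / 2) ∧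
      Continuous (Function.uncurry w) ∧
      HasKernel ((P₁ * P₂ + (1 - P₁) * (1 - P₂)) - 1) w := by
    have hp := half_pos hα
    have b12 := (conv_bd (c := α / 2) (by linarith) (by linarith) hp.le hb1 hb2).smul 2
    have c12 := conv_cont hα hα.le hb1 hb2 hcont₁ hcont₂
    have k12 := (HasKernel.mul hα hα hb1 hb2 hcont₁ hcont₂ hker₁ hker₂).smul 2
    have b11 := (hb1.smul (-1)).mono (b := α / 2) le_rfl (by linarith)
    have b22 := (hb2.smul (-1)).mono (b := α / 2) le_rfl (by linarith)
    have c12' : Continuous (Function.uncurry fun x y => ((2 : ℝ) : ℂ) * conv k₁ k₂ x y) :=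
      continuous_const.mul c12
    have c11 : Continuous (Function.uncurry fun x y => ((-1 : ℝ) : ℂ) * k₁ x y) :=
      continuous_const.mul hcont₁
    have c22 : Continuous (Function.uncurry fun x y => ((-1 : ℝ) : ℂ) * k₂ x y) :=
      continuous_const.mul hcont₂
    have k1 := HasKernel.add hp hp b12 b11 c12' c11 k12 (hker₁.smul (-1))
    have k2 := HasKernel.add hp hp (b12.add b11) b22 (c12'.add c11) c22 k1 (hker₂.smul (-1))
    refine ⟨_, _, (b12.add b11).add b22, (c12'.add c11).add c22, ?_⟩
    convert k2 using 1
    rw [two_smul, neg_one_smul, neg_one_smul]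
    simp only [mul_sub, sub_mul, one_mul, mul_one]
    abel
  have hb' := half_pos hb
  have b1 := conv_bd (c := b / 2) (by linarith) (by linarith) hb'.le hsb hwb
  have c1 := conv_cont hb (by linarith) hsb hwb hsc hwc
  have m1 := HasKernel.mul hb (half_pos hα) hsb hwb hsc hwc hs hw
  have b2 := b1.add (hsb.mono le_rfl (by linarith))
  have m2 := HasKernel.add hb' hb b1 hsb c1 hsc m1 hs
  have b3 := b2.add (hwb.mono (b := b / 2) le_rfl (by linarith))
  have m3 := HasKernel.add hb' (half_pos hα) b2 hwb (c1.add hsc) hwc m2 hw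
  refine ⟨_ + 1, b / 2, add_pos_of_nonneg_of_pos b3.nonneg one_pos, hb', by linarith,
    fun x y => conv s w x y + s x y + w x y, ?_,
    (c1.add hsc).add hwc, b3.mono (by linarith) le_rfl⟩
  convert m3 using 1
  simp only [mul_sub, sub_mul, one_mul, mul_one]
  abel
end
end
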